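/- arXiv:1812.04541 — 2 statements merged into one kernel-verified Lean document; each statement's English description precedes it below -/
import Mathlib

section
/- Let d ≥ 2 be even and let n = p + q > d with p, q ≥ 1. For any 0 < κ < n − d and for any ξ ∈ ℝ, for almost all F ∈ Y_{p,q}^{(d)} the system of inequalities |F(v) − ξ| < t^{−κ} and ‖v‖ ≤ t has a solution v ∈ ℤⁿ for all sufficiently large t. -/
open MeasureTheory Matrix Filter

noncomputable section

/-- `SL_n(ℝ)`. -/
abbrev SLR (n : ℕ) := Matrix.SpecialLinearGroup (Fin n) ℝ

instance (n : ℕ) : TopologicalSpace (SLR n) :=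
  TopologicalSpace.induced (fun g => (g : Matrix (Fin n) (Fin n) ℝ)) inferInstance

instance (n : ℕ) : MeasurableSpace (SLR n) := borel _

/-- Euclidean norm on `ℝⁿ`. -/
def eucNorm {n : ℕ} (v : Fin n → ℝ) : ℝ := Real.sqrt (∑ i, v i ^ 2)

/-- `F₀(v) = Σ_{i=1}^p v_i^d − Σ_{i=p+1}^n v_i^d` on `ℝ^{p+q}`. -/
def F0 (p q d : ℕ) (v : Fin (p + q) → ℝ) : ℝ :=
  ∑ i : Fin (p + q), (if (i : ℕ) < p then (1 : ℝ) else -1) * v i ^ d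

/-- The polynomial `F = g·F₀`, i.e. `F(v) = F₀(v g)` (row vectors, right action). -/
def Fg (p q d : ℕ) (g : SLR (p + q)) (v : Fin (p + q) → ℝ) : ℝ :=
  F0 p q d (Matrix.vecMul v (g : Matrix (Fin (p + q)) (Fin (p + q)) ℝ))

/-- The coercion `ℤⁿ → ℝⁿ`. -/
def intVec {n : ℕ} (v : Fin n → ℤ) : Fin n → ℝ := fun i => (v i : ℝ)

lemma volume_univ_unitAddCircle : (volume : Measure UnitAddCircle) Set.univ = 1 := by
  rw [AddCircle.measure_univ]; simp

instance : IsProbabilityMeasure (volume : Measure UnitAddCircle) := ⟨volume_univ_unitAddCircle⟩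

/-- The character `b ↦ ∑ i, M i • b i` of the torus attached to an integer vector `M`. -/
def torusHom {n : ℕ} (M : Fin n → ℤ) : (Fin n → UnitAddCircle) →+ UnitAddCircle where
  toFun b := ∑ i, M i • b i
  map_zero' := by simp
  map_add' a b := by simp [Finset.sum_add_distrib]

lemma continuous_torusHom {n : ℕ} (M : Fin n → ℤ) : Continuous (torusHom M) := by
  change Continuous fun b : Fin n → UnitAddCircle => ∑ i, M i • b i
  fun_prop

lemma torusHom_prod_surjective {n : ℕ} {M M' : Fin n → ℤ} {i j : Fin n}
    (h : M i * M' j ≠ M j * M' i) :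
    Function.Surjective ((torusHom M).prod (torusHom M')) := by
  rintro ⟨α, β⟩
  obtain ⟨x, rfl⟩ := QuotientAddGroup.mk_surjective α
  obtain ⟨y, rfl⟩ := QuotientAddGroup.mk_surjective β
  have hij : i ≠ j := by rintro rfl; exact h rfl
  set D : ℝ := (M i : ℝ) * M' j - M j * M' i with hD
  have hD0 : D ≠ 0 := by
    rw [hD, sub_ne_zero]; exact_mod_cast h
  have key : ∀ (K : Fin n → ℤ) (u v : ℝ),
      torusHom K (Pi.single i (u : UnitAddCircle) + Pi.single j (v : UnitAddCircle))
        = ((K i * u + K j * v : ℝ) : UnitAddCircle) := by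
    intro K u v
    have hs : ∀ (l : Fin n) (w : UnitAddCircle), torusHom K (Pi.single l w) = K l • w := by
      intro l w
      change ∑ m, K m • (Pi.single l w : Fin n → UnitAddCircle) m = _
      rw [Finset.sum_eq_single l]
      · simp
      · intro m _ hm; simp [hm]
      · simp
    rw [map_add, hs, hs, AddCircle.coe_add, ← zsmul_eq_mul, ← zsmul_eq_mul, AddCircle.coe_zsmul,
      AddCircle.coe_zsmul]
  refine ⟨Pi.single i (((x * M' j - M j * y) / D : ℝ) : UnitAddCircle)
    + Pi.single j (((M i * y - M' i * x) / D : ℝ) : UnitAddCircle), ?_⟩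
  rw [AddMonoidHom.prod_apply, key, key]
  have e1 : (M i : ℝ) * ((x * M' j - M j * y) / D) + M j * ((M i * y - M' i * x) / D) = x := by
    field_simp; rw [hD]; ring
  have e2 : (M' i : ℝ) * ((x * M' j - M j * y) / D) + M' j * ((M i * y - M' i * x) / D) = y := by
    field_simp; rw [hD]; ring
  rw [e1, e2]

lemma measurePreserving_torusHom_prod {n : ℕ} {M M' : Fin n → ℤ} {i j : Fin n}
    (h : M i * M' j ≠ M j * M' i) :
    MeasurePreserving ((torusHom M).prod (torusHom M')) volume
      ((volume : Measure UnitAddCircle).prod (volume : Measure UnitAddCircle)) :=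
  AddMonoidHom.measurePreserving
    ((continuous_torusHom M).prodMk (continuous_torusHom M')) (torusHom_prod_surjective h)
    (by rw [measure_univ, measure_univ])

lemma volume_torusHom_preimage {n : ℕ} {M : Fin n → ℤ} (hM : M ≠ 0) {A : Set UnitAddCircle}
    (hA : MeasurableSet A) : volume (torusHom M ⁻¹' A) = volume A := by
  obtain ⟨i, hi⟩ := Function.ne_iff.1 hM
  have hi : M i ≠ 0 := hi
  refine (AddMonoidHom.measurePreserving (continuous_torusHom M) (fun x => ?_)
    (by rw [measure_univ, measure_univ])).measure_preimage hA.nullMeasurableSet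
  obtain ⟨x, rfl⟩ := QuotientAddGroup.mk_surjective x
  refine ⟨Pi.single i ((x / M i : ℝ) : UnitAddCircle), ?_⟩
  change ∑ m, M m • (Pi.single i ((x / M i : ℝ) : UnitAddCircle) : Fin n → UnitAddCircle) m = _
  rw [Finset.sum_eq_single i]
  · rw [Pi.single_eq_same, ← AddCircle.coe_zsmul, zsmul_eq_mul, mul_div_cancel₀ _ (Int.cast_ne_zero.2 hi)]
  · intro m _ hm; simp [hm]
  · simp

lemma volume_torusHom_inter {n : ℕ} {M M' : Fin n → ℤ} {i j : Fin n}
    (h : M i * M' j ≠ M j * M' i) {A B : Set UnitAddCircle}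
    (hA : MeasurableSet A) (hB : MeasurableSet B) :
    volume (torusHom M ⁻¹' A ∩ torusHom M' ⁻¹' B) = volume A * volume B := by
  rw [← Measure.prod_prod, ← (measurePreserving_torusHom_prod h).measure_preimage
    (hA.prod hB).nullMeasurableSet]
  rfl

open ProbabilityTheory in
/-- Chebyshev's inequality for the number of occurring events in a pairwise independent family. -/
lemma measure_biInter_compl_le {Ω ι : Type*} [MeasurableSpace Ω] {P : Measure Ω}
    [IsProbabilityMeasure P] (S : Finset ι) (E : ι → Set Ω) (hE : ∀ i, MeasurableSet (E i))
    {r : ℝ} (hr : 0 < r) (hP : ∀ i ∈ S, P.real (E i) = r)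
    (hind : ∀ i ∈ S, ∀ j ∈ S, i ≠ j → P.real (E i ∩ E j) = r * r) (hS : S.Nonempty) :
    P.real (⋂ i ∈ S, (E i)ᶜ) ≤ 1 / (S.card * r) := by
  classical
  set N : ℝ := (S.card : ℝ) with hN
  have hN0 : 0 < N := by rw [hN]; exact_mod_cast hS.card_pos
  set f : Ω → ℝ := fun x => ∑ i ∈ S, ((E i).indicator 1 x - r) with hf
  have hint : ∀ i j, Integrable
      (fun x => ((E i).indicator (1 : Ω → ℝ) x - r) * ((E j).indicator 1 x - r)) P := by
    intro i j
    have hb : ∀ i x, |(E i).indicator (1 : Ω → ℝ) x - r| ≤ 1 + r := by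
      intro i x
      rw [abs_le]
      by_cases hx : x ∈ E i <;> simp only [hx, Set.indicator_of_mem, Set.indicator_of_notMem,
        not_false_eq_true, Pi.one_apply] <;> constructor <;> linarith
    have hm : ∀ i, Measurable fun x => (E i).indicator (1 : Ω → ℝ) x - r := fun i =>
      (measurable_one.indicator (hE i)).sub_const r
    refine Integrable.of_bound ((hm i).mul (hm j)).aestronglyMeasurable ((1 + r) * (1 + r))
      (ae_of_all _ fun x => ?_)
    rw [Real.norm_eq_abs, abs_mul]
    exact mul_le_mul (hb i x) (hb j x) (abs_nonneg _) (by linarith)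
  have hi1 : ∀ A : Set Ω, MeasurableSet A → Integrable (A.indicator (1 : Ω → ℝ)) P :=
    fun A hA => (integrable_const (1 : ℝ)).indicator hA
  have hcov : ∀ i ∈ S, ∀ j ∈ S,
      ∫ x, ((E i).indicator (1 : Ω → ℝ) x - r) * ((E j).indicator 1 x - r) ∂P
        = P.real (E i ∩ E j) - r * r := by
    intro i hi j hj
    have e : ∀ x, ((E i).indicator (1 : Ω → ℝ) x - r) * ((E j).indicator 1 x - r)
        = (E i ∩ E j).indicator 1 x - r * (E i).indicator 1 x - r * (E j).indicator 1 x
          + r * r := by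
      intro x
      by_cases h1 : x ∈ E i <;> by_cases h2 : x ∈ E j <;> simp [h1, h2] <;> ring
    have I0 : Integrable (fun x => (E i ∩ E j).indicator (1 : Ω → ℝ) x) P :=
      hi1 _ ((hE i).inter (hE j))
    have I1 := (hi1 _ (hE i)).const_mul r
    have I2 := (hi1 _ (hE j)).const_mul r
    simp_rw [e]
    have I3 : Integrable (fun x => (E i ∩ E j).indicator (1 : Ω → ℝ) x
      - r * (E i).indicator 1 x) P := I0.sub I1
    have I4 : Integrable (fun x => (E i ∩ E j).indicator (1 : Ω → ℝ) x
      - r * (E i).indicator 1 x - r * (E j).indicator 1 x) P := I3.sub I2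
    rw [integral_add I4 (integrable_const _), integral_sub I3 I2, integral_sub I0 I1, integral_const_mul, integral_const_mul,
      integral_indicator_one ((hE i).inter (hE j)), integral_indicator_one (hE i),
      integral_indicator_one (hE j), hP i hi, hP j hj]
    simp
  have hvar : ∫ x, f x * f x ∂P ≤ N * r := by
    have : ∀ x, f x * f x = ∑ i ∈ S, ∑ j ∈ S,
        ((E i).indicator (1 : Ω → ℝ) x - r) * ((E j).indicator 1 x - r) := by
      intro x; rw [hf, Finset.sum_mul_sum]
    simp_rw [this]
    rw [integral_finsetSum _ fun i _ => integrable_finsetSum _ fun j _ => hint i j]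
    calc _ = ∑ i ∈ S, ∑ j ∈ S, if i = j then r - r * r else 0 := by
          refine Finset.sum_congr rfl fun i hi => ?_
          rw [integral_finsetSum _ fun j _ => hint i j]
          refine Finset.sum_congr rfl fun j hj => ?_
          rw [hcov i hi j hj]
          split_ifs with h
          · subst h; rw [Set.inter_self, hP i hi]
          · rw [hind i hi j hj h, sub_self]
      _ = N * (r - r * r) := by
          simp [Finset.sum_ite_eq, hN, mul_sub]
      _ ≤ N * r := by nlinarith [mul_pos hr hr]
  have hff : Integrable (fun x => f x * f x) P := by
    have : (fun x => f x * f x) = fun x => ∑ i ∈ S, ∑ j ∈ S,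
        ((E i).indicator (1 : Ω → ℝ) x - r) * ((E j).indicator 1 x - r) := by
      ext x; rw [hf, Finset.sum_mul_sum]
    rw [this]
    exact integrable_finsetSum _ fun i _ => integrable_finsetSum _ fun j _ => hint i j
  have hmark := mul_meas_ge_le_integral_of_nonneg (μ := P)
    (ae_of_all _ fun x => mul_self_nonneg (f x)) hff ((N * r) * (N * r))
  have hsub : P.real (⋂ i ∈ S, (E i)ᶜ) ≤ P.real {x | N * r * (N * r) ≤ f x * f x} := by
    refine measureReal_mono fun x hx => ?_
    have hx' : ∀ i ∈ S, (E i).indicator (1 : Ω → ℝ) x = 0 := by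
      intro i hi
      have := Set.mem_iInter₂.1 hx i hi
      simpa using this
    have : f x = - (N * r) := by
      rw [hf]; simp only
      rw [Finset.sum_congr rfl fun i hi => by rw [hx' i hi]]
      simp [hN]
    rw [Set.mem_ofPred_eq, this]; apply le_of_eq; ring
  have hpos : 0 < N * r := mul_pos hN0 hr
  rw [le_div_iff₀ hpos]
  have := (mul_le_mul_of_nonneg_left hsub (mul_pos hpos hpos).le).trans (hmark.trans hvar)
  have h3 : (N * r) * (P.real (⋂ i ∈ S, (E i)ᶜ) * (N * r)) ≤ (N * r) * 1 := by linarith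
  exact le_of_mul_le_mul_left h3 hpos

lemma sum_Icc_two_inv_sq_le (E : ℕ) : ∑ e ∈ Finset.Icc 2 E, (1 : ℝ) / (e : ℝ) ^ 2 ≤ 3 / 4 := by
  rcases lt_or_ge E 2 with h | h
  · rw [Finset.Icc_eq_empty (by omega)]; norm_num
  · suffices H : ∑ e ∈ Finset.Icc 2 E, (1 : ℝ) / (e : ℝ) ^ 2 ≤ 3 / 4 - 1 / E by
      have : (0 : ℝ) ≤ 1 / E := by positivity
      linarith
    induction E, h using Nat.le_induction with
    | base => norm_num
    | succ k hk ih =>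
      rw [Finset.sum_Icc_succ_top (by omega)]
      have hk' : (2 : ℝ) ≤ k := by exact_mod_cast hk
      have : (1 : ℝ) / ((k + 1 : ℕ) : ℝ) ^ 2 ≤ 1 / k - 1 / ((k + 1 : ℕ) : ℝ) := by
        push_cast
        rw [div_sub_div _ _ (by positivity) (by positivity),
          div_le_div_iff₀ (by positivity) (by positivity)]
        nlinarith
      linarith

lemma card_Ico_filter_dvd_le (a : ℤ) (H e : ℕ) (he : 0 < e) :
    (((Finset.Ico a (a + H)).filter fun x => (e : ℤ) ∣ x).card : ℝ) ≤ H / e + 1 := by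
  have h := Int.Ico_filter_dvd_card a (a + H) (r := (e : ℤ)) (by exact_mod_cast he)
  have h1 : ((((Finset.Ico a (a + H)).filter fun x => (e : ℤ) ∣ x).card : ℤ) : ℚ) ≤ H / e + 1 := by
    rw [h, Int.cast_max, max_le_iff]
    constructor
    · push_cast
      have h2 := Int.ceil_lt_add_one (((a : ℚ) + H) / e)
      have h3 := Int.le_ceil ((a : ℚ) / e)
      rw [add_div] at h2
      rw [add_div]
      linarith
    · simp only [Int.cast_zero]; positivity
  have h2 := (Rat.cast_le (K := ℝ)).2 h1
  push_cast at h2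
  exact_mod_cast h2

lemma card_coprime_pairs_ge (X Y : ℤ) (H C : ℕ) (hX : 0 < X) (hC : X + H ≤ C * H) :
    (H : ℝ) ^ 2 / 8 - 7 * C * H ≤ (((Finset.Ico X (X + H) ×ˢ Finset.Ico Y (Y + H)).filter
      fun z => Int.gcd z.1 z.2 = 1).card : ℝ) := by
  classical
  set B := Finset.Ico X (X + H) ×ˢ Finset.Ico Y (Y + H) with hB
  have hBc : (B.card : ℝ) = (H : ℝ) ^ 2 := by
    rw [hB, Finset.card_product, Int.card_Ico, Int.card_Ico]; simp [sq]
  have hsplit := Finset.card_filter_add_card_filter_not (s := B) (fun z => Int.gcd z.1 z.2 = 1)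
  have hbad : (B.filter fun z => ¬ Int.gcd z.1 z.2 = 1) ⊆
      (Finset.Icc 2 (C * H)).biUnion fun e =>
        ((Finset.Ico X (X + H)).filter fun x => (e : ℤ) ∣ x) ×ˢ
        ((Finset.Ico Y (Y + H)).filter fun x => (e : ℤ) ∣ x) := by
    rintro ⟨x, y⟩ hz
    simp only [hB, Finset.mem_filter, Finset.mem_product, Finset.mem_Ico] at hz
    obtain ⟨⟨⟨hx1, hx2⟩, hy1, hy2⟩, hg⟩ := hz
    simp only [Finset.mem_biUnion, Finset.mem_Icc, Finset.mem_product, Finset.mem_filter,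
      Finset.mem_Ico]
    have h0 : Int.gcd x y ≠ 0 := by
      intro h; rw [Int.gcd_eq_zero_iff] at h; omega
    have hle : (Int.gcd x y : ℤ) ≤ x := Int.le_of_dvd (by omega) (Int.gcd_dvd_left x y)
    refine ⟨Int.gcd x y, ⟨by omega, ?_⟩, ⟨⟨hx1, hx2⟩, Int.gcd_dvd_left x y⟩,
      ⟨hy1, hy2⟩, Int.gcd_dvd_right x y⟩
    have : (Int.gcd x y : ℤ) ≤ (C * H : ℕ) := by push_cast; linarith
    exact_mod_cast this
  have hbadc : ((B.filter fun z => ¬ Int.gcd z.1 z.2 = 1).card : ℝ)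
      ≤ 7 / 8 * (H : ℝ) ^ 2 + 7 * C * H := by
    calc ((B.filter fun z => ¬ Int.gcd z.1 z.2 = 1).card : ℝ)
        ≤ ∑ e ∈ Finset.Icc 2 (C * H), ((((Finset.Ico X (X + H)).filter fun x => (e : ℤ) ∣ x) ×ˢ
          ((Finset.Ico Y (Y + H)).filter fun x => (e : ℤ) ∣ x)).card : ℝ) := by
          exact_mod_cast (Finset.card_le_card hbad).trans Finset.card_biUnion_le
      _ ≤ ∑ e ∈ Finset.Icc 2 (C * H), (7 / 6 * (H : ℝ) ^ 2 * (1 / (e : ℝ) ^ 2) + 7) := by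
          refine Finset.sum_le_sum fun e he => ?_
          have he0 : 0 < e := by have := (Finset.mem_Icc.1 he).1; omega
          have he0' : (0 : ℝ) < e := by exact_mod_cast he0
          rw [Finset.card_product, Nat.cast_mul]
          refine (mul_le_mul (card_Ico_filter_dvd_le X H e he0) (card_Ico_filter_dvd_le Y H e he0)
            (by positivity) (by positivity)).trans ?_
          have : 7 / 6 * (H : ℝ) ^ 2 * (1 / (e : ℝ) ^ 2) = 7 / 6 * (H / e : ℝ) ^ 2 := by
            rw [div_pow]; ring
          rw [this]
          nlinarith [sq_nonneg ((H / e : ℝ) - 6)]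
      _ ≤ 7 / 8 * (H : ℝ) ^ 2 + 7 * C * H := by
          rw [Finset.sum_add_distrib, ← Finset.mul_sum, Finset.sum_const, nsmul_eq_mul]
          have h1 := mul_le_mul_of_nonneg_left (sum_Icc_two_inv_sq_le (C * H))
            (show 0 ≤ 7 / 6 * (H : ℝ) ^ 2 by positivity)
          have h2 : ((Finset.Icc 2 (C * H)).card : ℝ) ≤ C * H := by
            rw [Nat.card_Icc]; exact_mod_cast (by omega : C * H + 1 - 2 ≤ C * H)
          nlinarith
  have hs : (((B.filter fun z => Int.gcd z.1 z.2 = 1).card : ℝ)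
      + (B.filter fun z => ¬ Int.gcd z.1 z.2 = 1).card) = (H : ℝ) ^ 2 := by
    rw [← hBc]; exact_mod_cast hsplit
  linarith

/-- Two integer vectors with a coprime pair of coordinates at the same place, the first of which is
positive, are equal as soon as they are parallel. -/
lemma eq_of_parallel_of_coprime {n : ℕ} {i1 i2 : Fin n} {M M' : Fin n → ℤ}
    (h : Int.gcd (M i1) (M i2) = 1) (h' : Int.gcd (M' i1) (M' i2) = 1)
    (hp : 0 < M i1) (hp' : 0 < M' i1) (hpar : ∀ i j, M i * M' j = M j * M' i) : M = M' := by
  have hc : IsCoprime (M i1) (M i2) := Int.isCoprime_iff_gcd_eq_one.2 h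
  have hc' : IsCoprime (M' i1) (M' i2) := Int.isCoprime_iff_gcd_eq_one.2 h'
  have d1 : M i1 ∣ M' i1 := hc.dvd_of_dvd_mul_left ⟨M' i2, (hpar i1 i2).symm⟩
  have d2 : M' i1 ∣ M i1 := hc'.dvd_of_dvd_mul_left ⟨M i2, by
    have := hpar i1 i2; linarith⟩
  have e : M i1 = M' i1 := Int.dvd_antisymm hp.le hp'.le d1 d2
  ext j
  have := hpar i1 j
  rw [e] at this
  have h2 : M' i1 * M' j = M' i1 * M j := by linarith
  exact (mul_left_cancel₀ hp'.ne' h2).symm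

lemma exists_large_nonparallel_family {n : ℕ} {i0 i1 i2 : Fin n} (h01 : i0 ≠ i1) (h02 : i0 ≠ i2)
    (h12 : i1 ≠ i2) (y : Fin n → ℝ) {η : ℝ} (hη : 0 < η) (hy : 0 < y i1) :
    ∃ c > 0, ∃ T₀ : ℝ, ∀ T ≥ T₀, ∃ S : Finset (Fin n → ℤ),
      c * T ^ (n - 1) ≤ S.card ∧
      (∀ M ∈ S, M i0 = 0 ∧ 0 < M i1 ∧ ∀ i ≠ i0, T * y i ≤ M i ∧ (M i : ℝ) ≤ T * (y i + η)) ∧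
      ∀ M ∈ S, ∀ M' ∈ S, M ≠ M' → ∃ i j, M i * M' j ≠ M j * M' i := by
  classical
  obtain ⟨C, hC⟩ := exists_nat_ge (2 * (y i1 + η + 1) / η)
  have hn3 : 3 ≤ n := by
    have : ({i0, i1, i2} : Finset (Fin n)).card = 3 := by
      rw [Finset.card_eq_three]; exact ⟨i0, i1, i2, h01, h02, h12, rfl⟩
    rw [← this]; simpa using Finset.card_le_univ ({i0, i1, i2} : Finset (Fin n))
  refine ⟨(η / 2) ^ (n - 1) / 16, by positivity, max 1 (max (2 / η) (224 * C / η)), fun T hT => ?_⟩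
  have hT1 : 1 ≤ T := (le_max_left _ _).trans hT
  have hT2 : 2 / η ≤ T := ((le_max_left _ _).trans (le_max_right _ _)).trans hT
  have hT3 : 224 * C / η ≤ T := ((le_max_right _ _).trans (le_max_right _ _)).trans hT
  have hT0 : 0 < T := by linarith
  rw [div_le_iff₀ hη] at hT2 hT3 hC
  set H : ℕ := ⌊η * T⌋₊ with hH
  have hH1 : (H : ℝ) ≤ η * T := Nat.floor_le (by positivity)
  have hH2 : η * T / 2 ≤ H := by
    have := Nat.lt_floor_add_one (η * T)
    rw [← hH] at this
    linarith
  set a : Fin n → ℤ := fun i => ⌈T * y i⌉ with ha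
  have hX : 0 < a i1 := Int.ceil_pos.2 (by positivity)
  have ha1 : ∀ i, T * y i ≤ a i := fun i => Int.le_ceil _
  have ha2 : ∀ i, (a i : ℝ) < T * y i + 1 := fun i => Int.ceil_lt_add_one _
  have hXC : a i1 + H ≤ C * H := by
    have : (a i1 : ℝ) + H ≤ C * H := by
      have h1 := ha2 i1
      have h2 : (C : ℝ) * (η * T / 2) ≤ C * H := mul_le_mul_of_nonneg_left hH2 (by positivity)
      nlinarith
    exact_mod_cast this
  have hcount := card_coprime_pairs_ge (a i1) (a i2) H C hX hXC
  set Q := ((Finset.Ico (a i1) (a i1 + H) ×ˢ Finset.Ico (a i2) (a i2 + H)).filter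
      fun z => Int.gcd z.1 z.2 = 1) with hQ
  have hmem : ∀ {i : Fin n} {z : ℤ}, z ∈ Finset.Ico (a i) (a i + H) →
      T * y i ≤ z ∧ (z : ℝ) ≤ T * (y i + η) := by
    intro i z hz
    rw [Finset.mem_Ico] at hz
    have h1 : (a i : ℝ) ≤ z := by exact_mod_cast hz.1
    have h2 : (z : ℝ) + 1 ≤ a i + H := by exact_mod_cast hz.2
    constructor
    · linarith [ha1 i]
    · linarith [ha2 i]
  set R := Fintype.piFinset fun i : Fin n =>
    if i ∈ ({i0, i1, i2} : Finset (Fin n)) then ({0} : Finset ℤ) else Finset.Ico (a i) (a i + H)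
    with hR
  have hRc : R.card = H ^ (n - 3) := by
    rw [hR, Fintype.card_piFinset]
    have : ∀ i, (if i ∈ ({i0, i1, i2} : Finset (Fin n)) then ({0} : Finset ℤ)
        else Finset.Ico (a i) (a i + H)).card
        = if i ∈ ({i0, i1, i2} : Finset (Fin n)) then 1 else H := by
      intro i; split_ifs <;> simp
    simp_rw [this]
    rw [Finset.prod_ite, Finset.prod_const_one, one_mul, Finset.prod_const]
    congr 1
    have h3 : ({i0, i1, i2} : Finset (Fin n)).card = 3 := by
      rw [Finset.card_eq_three]; exact ⟨i0, i1, i2, h01, h02, h12, rfl⟩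
    have : (Finset.univ.filter fun i => i ∉ ({i0, i1, i2} : Finset (Fin n)))
        = ({i0, i1, i2} : Finset (Fin n))ᶜ := by ext; simp
    rw [this, Finset.card_compl, h3, Fintype.card_fin]
  have hRmem : ∀ f ∈ R, f i0 = 0 ∧ f i1 = 0 ∧ f i2 = 0 ∧
      ∀ i, i ≠ i0 → i ≠ i1 → i ≠ i2 → f i ∈ Finset.Ico (a i) (a i + H) := by
    intro f hf
    rw [hR, Fintype.mem_piFinset] at hf
    refine ⟨by simpa using hf i0, by simpa using hf i1, by simpa using hf i2, fun i h0 h1 h2 => ?_⟩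
    have := hf i
    rwa [if_neg (by simp [h0, h1, h2])] at this
  set φ : (ℤ × ℤ) × (Fin n → ℤ) → Fin n → ℤ := fun z =>
    Function.update (Function.update z.2 i1 z.1.1) i2 z.1.2 with hφ
  have φ1 : ∀ z, φ z i1 = z.1.1 := fun z => by simp [hφ, h12]
  have φ2 : ∀ z, φ z i2 = z.1.2 := fun z => by simp [hφ]
  have φ3 : ∀ z i, i ≠ i1 → i ≠ i2 → φ z i = z.2 i := fun z i h1 h2 => by simp [hφ, h1, h2]
  have hinj : Set.InjOn φ (Q ×ˢ R : Finset _) := by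
    rintro ⟨⟨x, y⟩, f⟩ hz ⟨⟨x', y'⟩, f'⟩ hz' heq
    simp only [Finset.mem_coe, Finset.mem_product] at hz hz'
    have e1 : x = x' := by simpa [φ1] using congrFun heq i1
    have e2 : y = y' := by simpa [φ2] using congrFun heq i2
    have e3 : f = f' := by
      ext i
      obtain ⟨-, p1, p2, -⟩ := hRmem f hz.2
      obtain ⟨-, q1, q2, -⟩ := hRmem f' hz'.2
      by_cases k1 : i = i1
      · rw [k1, p1, q1]
      by_cases k2 : i = i2
      · rw [k2, p2, q2]
      have := congrFun heq i
      rwa [φ3 _ i k1 k2, φ3 _ i k1 k2] at this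
    rw [e1, e2, e3]
  have key : ∀ M ∈ (Q ×ˢ R).image φ, Int.gcd (M i1) (M i2) = 1 ∧ M i0 = 0 ∧ 0 < M i1 ∧
      ∀ i ≠ i0, T * y i ≤ M i ∧ (M i : ℝ) ≤ T * (y i + η) := by
    intro M hM
    obtain ⟨z, hz, rfl⟩ := Finset.mem_image.1 hM
    rw [Finset.mem_product] at hz
    obtain ⟨hz1, hz2⟩ := hz
    rw [hQ, Finset.mem_filter, Finset.mem_product] at hz1
    obtain ⟨r0, r1, r2, r3⟩ := hRmem _ hz2
    refine ⟨by rw [φ1, φ2]; exact hz1.2, by rw [φ3 _ _ h01 h02, r0], ?_, fun i hi => ?_⟩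
    · rw [φ1]; exact hX.trans_le (Finset.mem_Ico.1 hz1.1.1).1
    · by_cases k1 : i = i1
      · subst k1; rw [φ1]; exact hmem hz1.1.1
      by_cases k2 : i = i2
      · subst k2; rw [φ2]; exact hmem hz1.1.2
      rw [φ3 _ _ k1 k2]
      exact hmem (r3 i hi k1 k2)
  refine ⟨(Q ×ˢ R).image φ, ?_, fun M hM => (key M hM).2, fun M hM M' hM' hne => ?_⟩
  · rw [Finset.card_image_of_injOn hinj, Finset.card_product, hRc, Nat.cast_mul, Nat.cast_pow]
    have hHC : (112 * C : ℝ) ≤ H := by linarith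
    have h16 : (H : ℝ) ^ 2 / 16 ≤ Q.card := by nlinarith
    calc (η / 2) ^ (n - 1) / 16 * T ^ (n - 1) = (η * T / 2) ^ (n - 1) / 16 := by
          rw [div_mul_eq_mul_div, ← mul_pow]; congr 2; ring
      _ ≤ (H : ℝ) ^ (n - 1) / 16 := by gcongr
      _ = (H : ℝ) ^ 2 / 16 * H ^ (n - 3) := by
          rw [show n - 1 = 2 + (n - 3) by omega, pow_add]; ring
      _ ≤ _ := by gcongr
  · by_contra! hcon
    exact hne (eq_of_parallel_of_coprime (key M hM).1 (key M' hM').1 (key M hM).2.2.1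
      (key M' hM').2.2.1 hcon)

/-- Near a line on which an even continuous function changes sign, there is a box, on the side where
a prescribed coordinate is positive, all of whose lines in that direction show the sign change. -/
lemma exists_box_of_sign_change {n : ℕ} {i0 i1 : Fin n} {P : (Fin n → ℝ) → ℝ}
    (hP : Continuous P) (heven : ∀ x, P (-x) = P x) {y : Fin n → ℝ} {s : ℝ}
    (hy : 0 < P y) (hys : P (y + Pi.single i0 s) < 0) :
    ∃ (z : Fin n → ℝ) (r η c : ℝ), 0 < z i1 ∧ 0 < η ∧ 0 < c ∧ ∀ z', (∀ i, |z' i - z i| ≤ η) →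
      c < P z' ∧ P (z' + Pi.single i0 r) < -c := by
  -- move off the hyperplane where the coordinate vanishes
  obtain ⟨z, r, hz0, hz1, hz2⟩ : ∃ (z : Fin n → ℝ) (r : ℝ), z i1 ≠ 0 ∧ 0 < P z ∧
      P (z + Pi.single i0 r) < 0 := by
    have hc : Continuous fun e : ℝ => y + Pi.single i1 e := by
      refine continuous_const.add ?_
      exact continuous_single (A := fun _ : Fin n => ℝ) i1
    have e1 : ∀ᶠ e : ℝ in nhds 0, 0 < P (y + Pi.single i1 e) :=
      ((hP.comp hc).tendsto' 0 (P y) (by simp)).eventually (lt_mem_nhds hy)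
    have e2 : ∀ᶠ e : ℝ in nhds 0, P (y + Pi.single i1 e + Pi.single i0 s) < 0 :=
      ((hP.comp (hc.add continuous_const)).tendsto' 0 (P (y + Pi.single i0 s))
        (by simp)).eventually (gt_mem_nhds hys)
    by_cases h : y i1 = 0
    · obtain ⟨e, ⟨he1, he2⟩, he0⟩ := (((e1.and e2).filter_mono nhdsWithin_le_nhds).and
        (self_mem_nhdsWithin : {0}ᶜ ∈ nhdsWithin (0 : ℝ) {0}ᶜ)).exists
      exact ⟨_, s, by simpa [h] using he0, he1, he2⟩
    · exact ⟨y, s, h, hy, hys⟩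
  obtain ⟨z, r, hz0, hz1, hz2⟩ : ∃ (z : Fin n → ℝ) (r : ℝ), 0 < z i1 ∧ 0 < P z ∧
      P (z + Pi.single i0 r) < 0 := by
    rcases lt_or_gt_of_ne hz0 with h | h
    · refine ⟨-z, -r, by simpa using h, by rwa [heven], ?_⟩
      rw [show -z + Pi.single i0 (-r) = -(z + Pi.single i0 r) by
        rw [Pi.single_neg, neg_add], heven]
      exact hz2
    · exact ⟨z, r, h, hz1, hz2⟩
  set c := min (P z) (-P (z + Pi.single i0 r)) / 2 with hc
  have hm : 0 < min (P z) (-P (z + Pi.single i0 r)) := lt_min hz1 (by linarith)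
  have hc0 : 0 < c := by rw [hc]; linarith
  have hcz : c < P z := by have := min_le_left (P z) (-P (z + Pi.single i0 r)); linarith
  have hcz' : P (z + Pi.single i0 r) < -c := by
    have := min_le_right (P z) (-P (z + Pi.single i0 r)); linarith
  have e1 : ∀ᶠ z' in nhds z, c < P z' := hP.continuousAt.eventually (lt_mem_nhds hcz)
  have e2 : ∀ᶠ z' in nhds z, P (z' + Pi.single i0 r) < -c :=
    ((hP.comp (continuous_id.add continuous_const)).continuousAt (x := z)).eventually
      (gt_mem_nhds hcz')
  obtain ⟨η, hη, hball⟩ := Metric.nhds_basis_closedBall.eventually_iff.1 (e1.and e2)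
  refine ⟨z, r, η, c, by assumption, hη, hc0, fun z' hz' => hball ?_⟩
  rw [Metric.mem_closedBall, dist_pi_le_iff hη.le]
  exact hz'

/-- A homogeneous `C¹` function of degree `d` is Lipschitz with constant `O(T ^ (d - 1))` on the
cube of size `T`. -/
lemma exists_lipschitz_const_of_homogeneous {n d : ℕ} (hd : 1 ≤ d) (i0 : Fin n)
    {P : (Fin n → ℝ) → ℝ} (hP : ContDiff ℝ 1 P) (hhom : ∀ (t : ℝ) x, P (t • x) = t ^ d * P x)
    (R : ℝ) :
    ∃ L : ℝ, 0 ≤ L ∧ ∀ T > 0, ∀ x x' : Fin n → ℝ, (∀ i, |x i| ≤ R * T) → (∀ i, |x' i| ≤ R * T) →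
      |P x - P x'| ≤ L * T ^ (d - 1) * ‖x - x'‖ := by
  obtain ⟨L, hL⟩ := hP.locallyLipschitz.locallyLipschitzOn.exists_lipschitzOnWith_of_compact
    (isCompact_closedBall (0 : Fin n → ℝ) R)
  refine ⟨L, L.2, fun T hT x x' hx hx' => ?_⟩
  have hR : 0 ≤ R := by
    have := (abs_nonneg _).trans (hx i0)
    exact nonneg_of_mul_nonneg_left this hT
  have hmem : ∀ x : Fin n → ℝ, (∀ i, |x i| ≤ R * T) →
      T⁻¹ • x ∈ Metric.closedBall (0 : Fin n → ℝ) R := by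
    intro x hx
    rw [mem_closedBall_zero_iff, pi_norm_le_iff_of_nonneg hR]
    intro i
    rw [Pi.smul_apply, smul_eq_mul, Real.norm_eq_abs, abs_mul, abs_of_pos (inv_pos.2 hT),
      inv_mul_le_iff₀ hT, mul_comm]
    exact hx i
  have h := hL.dist_le_mul _ (hmem x hx) _ (hmem x' hx')
  have e : ∀ x, P x = T ^ d * P (T⁻¹ • x) := by
    intro x; rw [← hhom, smul_smul, mul_inv_cancel₀ hT.ne', one_smul]
  rw [e x, e x', ← mul_sub, abs_mul, abs_of_pos (pow_pos hT d)]
  rw [Real.dist_eq, dist_eq_norm, ← smul_sub, norm_smul, Real.norm_of_nonneg (inv_pos.2 hT).le] at h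
  calc _ ≤ T ^ d * (L * (T⁻¹ * ‖x - x'‖)) := mul_le_mul_of_nonneg_left h (pow_pos hT d).le
    _ = _ := by
      obtain ⟨k, rfl⟩ : ∃ k, d = k + 1 := ⟨d - 1, by omega⟩
      rw [Nat.add_sub_cancel, pow_succ]
      field_simp

lemma exists_root_with_bound {n d : ℕ} (hd : 1 ≤ d) (i0 : Fin n)
    {P : (Fin n → ℝ) → ℝ} (hP : ContDiff ℝ 1 P) (hhom : ∀ (t : ℝ) x, P (t • x) = t ^ d * P x)
    {z : Fin n → ℝ} {r η c : ℝ} (hη : 0 < η) (hc : 0 < c)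
    (hbox : ∀ z', (∀ i, |z' i - z i| ≤ η) → c < P z' ∧ P (z' + Pi.single i0 r) < -c) (ξ : ℝ) :
    ∃ C T₀ : ℝ, 0 ≤ C ∧ ∀ T ≥ T₀, ∀ x : Fin n → ℝ, x i0 = 0 →
      (∀ i ≠ i0, T * z i ≤ x i ∧ x i ≤ T * (z i + η)) →
      (∀ i, |x i| ≤ C * T) ∧
      ∃ W : ℝ, |W| ≤ C * T ∧ ∀ w : ℝ, |w - W| ≤ 1 →
        |P (x + Pi.single i0 w) - ξ| ≤ C * T ^ (d - 1) * |w - W| := by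
  set K : ℝ := ‖z‖ + η + |r| with hK
  have hK0 : 0 ≤ K := by positivity
  obtain ⟨L, hL0, hL⟩ := exists_lipschitz_const_of_homogeneous hd i0 hP hhom (K + 1)
  refine ⟨max L K, max 1 (|ξ| / c), le_max_of_le_right hK0, fun T hT x hx0 hx => ?_⟩
  have hT1 : 1 ≤ T := (le_max_left _ _).trans hT
  have hT0 : 0 < T := by linarith
  have hT2 : |ξ| ≤ T * c := (div_le_iff₀ hc).1 ((le_max_right _ _).trans hT)
  have hξ : |ξ| ≤ T ^ d * c := by
    refine hT2.trans (mul_le_mul_of_nonneg_right ?_ hc.le)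
    exact le_self_pow₀ hT1 (by omega)
  have hzi : ∀ i, |z i| ≤ ‖z‖ := fun i => by simpa using norm_le_pi_norm z i
  have hxK : ∀ i, |x i| ≤ K * T := by
    intro i
    by_cases hi : i = i0
    · subst hi; rw [hx0, abs_zero]; positivity
    · obtain ⟨h1, h2⟩ := hx i hi
      have := abs_le.1 (hzi i)
      have h3 := abs_nonneg r
      rw [abs_le]
      constructor <;> nlinarith
  set z' : Fin n → ℝ := T⁻¹ • x + Pi.single i0 (z i0) with hz'
  have hxz : ∀ s : ℝ, x + Pi.single i0 (T * (z i0 + s)) = T • (z' + Pi.single i0 s) := by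
    intro s
    ext i
    by_cases hi : i = i0
    · subst hi; simp [hz', hx0]
    · simp [hz', hi, hT0.ne']
  obtain ⟨b1, b2⟩ := hbox z' (by
    intro i
    by_cases hi : i = i0
    · subst hi; simp [hz', hx0, hη.le]
    · obtain ⟨h1, h2⟩ := hx i hi
      have e : z' i = x i / T := by simp [hz', hi, div_eq_inv_mul]
      rw [e, abs_le]
      have h1' : z i ≤ x i / T := by rw [le_div_iff₀ hT0]; linarith
      have h2' : x i / T ≤ z i + η := by rw [div_le_iff₀ hT0]; linarith
      constructor <;> linarith)
  set f : ℝ → ℝ := fun s => P (x + Pi.single i0 (T * (z i0 + s))) with hf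
  have hfc : Continuous f := by
    refine hP.continuous.comp (continuous_const.add ?_)
    exact (continuous_single (A := fun _ : Fin n => ℝ) i0).comp (by fun_prop)
  have hTd : 0 < T ^ d := pow_pos hT0 d
  have f0 : ξ ≤ f 0 := by
    rw [hf]; simp only
    rw [hxz, hhom, Pi.single_zero, add_zero]
    exact (le_abs_self ξ).trans (hξ.trans (mul_le_mul_of_nonneg_left b1.le hTd.le))
  have fr : f r ≤ ξ := by
    rw [hf]; simp only
    rw [hxz, hhom]
    have h1 := mul_le_mul_of_nonneg_left b2.le hTd.le
    have h2 := neg_abs_le ξ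
    linarith
  obtain ⟨s, hs, hfs⟩ : ξ ∈ f '' Set.uIcc 0 r :=
    intermediate_value_uIcc hfc.continuousOn (Set.mem_uIcc.2 (Or.inr ⟨fr, f0⟩))
  have hsr : |s| ≤ |r| := by simpa using Set.abs_sub_left_of_mem_uIcc hs
  have hW : |T * (z i0 + s)| ≤ K * T := by
    rw [abs_mul, abs_of_pos hT0, mul_comm]
    refine mul_le_mul_of_nonneg_right ?_ hT0.le
    have := abs_add_le (z i0) s
    have := hzi i0
    linarith
  have hKC : K * T ≤ max L K * T := mul_le_mul_of_nonneg_right (le_max_right _ _) hT0.le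
  refine ⟨fun i => (hxK i).trans hKC, T * (z i0 + s), hW.trans hKC, fun w hw => ?_⟩
  have hcoord : ∀ v : ℝ, |v| ≤ (K + 1) * T → ∀ i, |(x + Pi.single i0 v : Fin n → ℝ) i| ≤ (K + 1) * T := by
    intro v hv i
    by_cases hi : i = i0
    · subst hi; simpa [hx0] using hv
    · have := hxK i
      simp only [Pi.add_apply, Pi.single_eq_of_ne hi, add_zero]
      linarith
  have hw' : |w| ≤ (K + 1) * T := by
    have := abs_sub_abs_le_abs_sub w (T * (z i0 + s))
    linarith
  have h := hL T hT0 _ _ (hcoord w hw') (hcoord (T * (z i0 + s)) (by linarith))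
  have e : ‖(x + Pi.single i0 w) - (x + Pi.single i0 (T * (z i0 + s)) : Fin n → ℝ)‖ = |w - T * (z i0 + s)| := by
    rw [add_sub_add_left_eq_sub, ← Pi.single_sub, Pi.norm_single, Real.norm_eq_abs]
  rw [e, show P (x + Pi.single i0 (T * (z i0 + s))) = ξ from hfs] at h
  refine h.trans ?_
  have : L ≤ max L K := le_max_left _ _
  gcongr

/-- The representative in `[0, 1)` of a point of the circle. -/
def circleLift (x : UnitAddCircle) : ℝ := (AddCircle.measurableEquivIco 1 0 x : ℝ)

lemma measurable_circleLift : Measurable circleLift :=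
  measurable_subtype_coe.comp (AddCircle.measurableEquivIco 1 0).measurable

lemma coe_circleLift (x : UnitAddCircle) : (circleLift x : UnitAddCircle) = x :=
  (AddCircle.equivIco 1 0).symm_apply_apply x

lemma abs_circleLift_le (x : UnitAddCircle) : |circleLift x| ≤ 1 := by
  have h : circleLift x ∈ Set.Ico (0 : ℝ) (0 + 1) := (AddCircle.measurableEquivIco 1 0 x).2
  rw [zero_add] at h
  rw [abs_of_nonneg h.1]
  exact h.2.le

/-- The vector of lifts of a point of the torus, with the coordinate `i0` replaced by `0`. -/
def shearVec {n : ℕ} (i0 : Fin n) (b : Fin n → UnitAddCircle) : Fin n → ℝ :=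
  fun i => if i = i0 then 0 else circleLift (b i)

lemma coe_dotProduct_shearVec {n : ℕ} {i0 : Fin n} {M : Fin n → ℤ} (hM : M i0 = 0)
    (b : Fin n → UnitAddCircle) :
    ((intVec M ⬝ᵥ shearVec i0 b : ℝ) : UnitAddCircle) = torusHom M b := by
  change QuotientAddGroup.mk' _ (∑ i, intVec M i * shearVec i0 b i) = ∑ i, M i • b i
  rw [map_sum]
  refine Finset.sum_congr rfl fun i _ => ?_
  by_cases hi : i = i0
  · subst hi; simp [intVec, hM]
  · rw [shearVec, if_neg hi]
    conv_rhs => rw [← coe_circleLift (b i), ← AddCircle.coe_zsmul, zsmul_eq_mul]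
    rfl

lemma abs_shearVec_le {n : ℕ} (i0 : Fin n) (b : Fin n → UnitAddCircle) (i : Fin n) :
    |shearVec i0 b i| ≤ 1 := by
  rw [shearVec]
  split_ifs
  · simp
  · exact abs_circleLift_le _

/-- A translate of `m` by an integer is within `δ` of `W` once this holds modulo `1`. -/
lemma exists_int_abs_add_sub_le {m W δ : ℝ} (h : ‖(m : UnitAddCircle) - (W : UnitAddCircle)‖ ≤ δ) :
    ∃ j : ℤ, |(j + m) - W| ≤ δ := by
  rw [← AddCircle.coe_sub, UnitAddCircle.norm_eq] at h
  refine ⟨-round (m - W), ?_⟩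
  push_cast
  rwa [show -(round (m - W) : ℝ) + m - W = m - W - round (m - W) by ring]

/-- At scale `T`, the sheared values of `P` at integer vectors approximate `ξ` outside a set of
small measure. -/
lemma measure_not_approximable_le {n d : ℕ} {i0 i1 i2 : Fin n} (h01 : i0 ≠ i1) (h02 : i0 ≠ i2)
    (h12 : i1 ≠ i2) (hd : 1 ≤ d) {P : (Fin n → ℝ) → ℝ} (hP : ContDiff ℝ 1 P)
    (hhom : ∀ (t : ℝ) x, P (t • x) = t ^ d * P x) (heven : ∀ x, P (-x) = P x)
    {y : Fin n → ℝ} {s : ℝ} (hy : 0 < P y) (hys : P (y + Pi.single i0 s) < 0) (ξ : ℝ) :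
    ∃ (C : ℕ) (A T₀ : ℝ), ∀ T ≥ T₀, ∀ δ : ℝ, 0 < δ → δ ≤ 1 / 2 →
      volume {b : Fin n → UnitAddCircle | ¬ ∃ v : Fin n → ℤ,
        |P (intVec v + Pi.single i0 (intVec v ⬝ᵥ shearVec i0 b)) - ξ| ≤ C * (T ^ (d - 1) * δ) ∧
        ∀ i, |(v i : ℝ)| ≤ C * T} ≤ ENNReal.ofReal (A / (T ^ (n - 1) * δ)) := by
  obtain ⟨z, r, η, c, hz, hη, hc, hbox⟩ :=
    exists_box_of_sign_change (i0 := i0) (i1 := i1) hP.continuous heven hy hys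
  obtain ⟨C, T₁, hC, hroot⟩ := exists_root_with_bound hd i0 hP hhom hη hc hbox ξ
  obtain ⟨a, ha, T₂, hfam⟩ := exists_large_nonparallel_family h01 h02 h12 z hη hz
  obtain ⟨C', hC'⟩ := exists_nat_ge (C + 1 + n * C)
  have hCC' : C ≤ C' := by
    have : 0 ≤ n * C := by positivity
    linarith
  refine ⟨C', 1 / (2 * a), max 1 (max T₁ T₂), fun T hT δ hδ hδ' => ?_⟩
  have hT1 : 1 ≤ T := (le_max_left _ _).trans hT
  have hT0 : 0 < T := by linarith
  obtain ⟨S, hS, hSmem, hSpar⟩ := hfam T (((le_max_right _ _).trans (le_max_right _ _)).trans hT)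
  have hroot' := hroot T (((le_max_left _ _).trans (le_max_right _ _)).trans hT)
  have hS0 : (0 : ℝ) < S.card := lt_of_lt_of_le (by positivity) hS
  have hW : ∀ M : Fin n → ℤ, ∃ W : ℝ, M ∈ S → (∀ i, |(M i : ℝ)| ≤ C * T) ∧ |W| ≤ C * T ∧
      ∀ w : ℝ, |w - W| ≤ 1 →
        |P (intVec M + Pi.single i0 w) - ξ| ≤ C * T ^ (d - 1) * |w - W| := by
    intro M
    by_cases hM : M ∈ S
    · obtain ⟨m0, -, m2⟩ := hSmem M hM
      obtain ⟨h1, W, h2⟩ := hroot' (intVec M) (by simp [intVec, m0]) m2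
      exact ⟨W, fun _ => ⟨h1, h2⟩⟩
    · exact ⟨0, fun h => absurd h hM⟩
  choose W hW using hW
  set E : (Fin n → ℤ) → Set (Fin n → UnitAddCircle) := fun M =>
    torusHom M ⁻¹' Metric.closedBall (W M : UnitAddCircle) δ with hE
  have hball : ∀ x : UnitAddCircle, volume (Metric.closedBall x δ) = ENNReal.ofReal (2 * δ) := by
    intro x
    rw [AddCircle.volume_closedBall, min_eq_right (by linarith)]
  have hreal : ∀ x : UnitAddCircle, volume.real (Metric.closedBall x δ) = 2 * δ := by
    intro x
    rw [Measure.real, hball, ENNReal.toReal_ofReal (by positivity)]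
  have hmb : ∀ x : UnitAddCircle, MeasurableSet (Metric.closedBall x δ) := fun x =>
    Metric.isClosed_closedBall.measurableSet
  have hcheb := measure_biInter_compl_le (P := (volume : Measure (Fin n → UnitAddCircle))) S E
    (fun M => (continuous_torusHom M).measurable (hmb _)) (r := 2 * δ) (by positivity)
    (fun M hM => by
      have hM0 : M ≠ 0 := by
        rintro rfl
        exact lt_irrefl _ (hSmem 0 hM).2.1
      rw [Measure.real, hE, volume_torusHom_preimage hM0 (hmb _)]
      exact hreal _)
    (fun M hM M' hM' hne => by
      obtain ⟨i, j, hij⟩ := hSpar M hM M' hM' hne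
      rw [Measure.real, hE, volume_torusHom_inter hij (hmb _) (hmb _), ENNReal.toReal_mul]
      exact congrArg₂ _ (hreal _) (hreal _))
    (Finset.card_pos.1 (by exact_mod_cast hS0))
  have hsub : {b : Fin n → UnitAddCircle | ¬ ∃ v : Fin n → ℤ,
        |P (intVec v + Pi.single i0 (intVec v ⬝ᵥ shearVec i0 b)) - ξ| ≤ C' * (T ^ (d - 1) * δ) ∧
        ∀ i, |(v i : ℝ)| ≤ C' * T} ⊆ ⋂ M ∈ S, (E M)ᶜ := by
    intro b hb
    refine Set.mem_iInter₂.2 fun M hM hbE => hb ?_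
    obtain ⟨m0, -, -⟩ := hSmem M hM
    obtain ⟨h1, h2, h3⟩ := hW M hM
    rw [hE, Set.mem_preimage, mem_closedBall_iff_norm, ← coe_dotProduct_shearVec m0] at hbE
    obtain ⟨j, hj⟩ := exists_int_abs_add_sub_le hbE
    set m := intVec M ⬝ᵥ shearVec i0 b with hm
    have hm' : |m| ≤ n * C * T := by
      calc |m| ≤ ∑ i, |intVec M i * shearVec i0 b i| := Finset.abs_sum_le_sum_abs _ _
        _ ≤ ∑ i : Fin n, C * T := by
          refine Finset.sum_le_sum fun i _ => ?_
          rw [abs_mul]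
          exact (mul_le_of_le_one_right (abs_nonneg _) (abs_shearVec_le _ _ _)).trans (h1 i)
        _ = n * C * T := by simp [mul_assoc]
    have hv : intVec (Function.update M i0 j) = intVec M + Pi.single i0 (j : ℝ) := by
      ext i
      by_cases hi : i = i0
      · subst hi; simp [intVec, m0]
      · simp [intVec, hi]
    have hdot : intVec (Function.update M i0 j) ⬝ᵥ shearVec i0 b = m := by
      rw [hv, add_dotProduct, single_dotProduct]
      simp [shearVec, hm]
    refine ⟨Function.update M i0 j, ?_, fun i => ?_⟩
    · rw [hdot, hv, add_assoc, ← Pi.single_add]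
      refine (h3 (j + m) (hj.trans (by linarith))).trans ?_
      rw [mul_assoc]
      gcongr
    · by_cases hi : i = i0
      · subst hi
        rw [Function.update_self]
        have e1 := abs_sub_abs_le_abs_sub ((j : ℝ) + m) (W M)
        have e2 : |(j : ℝ)| ≤ |j + m| + |m| := by
          have := abs_sub ((j : ℝ) + m) m
          rwa [add_sub_cancel_right] at this
        have e3 : (C + 1 + n * C) * T ≤ C' * T := mul_le_mul_of_nonneg_right hC' hT0.le
        nlinarith
      · rw [Function.update_of_ne hi]
        exact (h1 i).trans (mul_le_mul_of_nonneg_right hCC' hT0.le)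
  refine (measure_mono hsub).trans ?_
  rw [← ENNReal.ofReal_toReal (measure_ne_top volume _)]
  refine ENNReal.ofReal_le_ofReal (hcheb.trans ?_)
  rw [div_div]
  refine one_div_le_one_div_of_le (by positivity) ?_
  nlinarith

/-- Almost every shear makes the values of `P` approximate `ξ` at all dyadic scales. -/
lemma ae_forall_dyadic_approximable {n d : ℕ} {i0 i1 i2 : Fin n} (h01 : i0 ≠ i1) (h02 : i0 ≠ i2)
    (h12 : i1 ≠ i2) (hd : 1 ≤ d) {P : (Fin n → ℝ) → ℝ} (hP : ContDiff ℝ 1 P)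
    (hhom : ∀ (t : ℝ) x, P (t • x) = t ^ d * P x) (heven : ∀ x, P (-x) = P x)
    {y : Fin n → ℝ} {s : ℝ} (hy : 0 < P y) (hys : P (y + Pi.single i0 s) < 0) (ξ : ℝ)
    {κ : ℝ} (hκ0 : 0 < κ) (hκ : κ < (n : ℝ) - d) :
    ∀ᵐ b : Fin n → UnitAddCircle, ∃ C k₀ : ℕ, ∀ k ≥ k₀, ∃ v : Fin n → ℤ,
        |P (intVec v + Pi.single i0 (intVec v ⬝ᵥ shearVec i0 b)) - ξ| ≤ C * ((2 : ℝ) ^ k) ^ (-κ) ∧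
        ∀ i, |(v i : ℝ)| ≤ C * (2 : ℝ) ^ k := by
  obtain ⟨C, A, T₀, hmeas⟩ :=
    measure_not_approximable_le h01 h02 h12 hd hP hhom heven hy hys ξ
  obtain ⟨k₁, hk₁⟩ := pow_unbounded_of_one_lt T₀ (one_lt_two (α := ℝ))
  obtain ⟨k₂, hk₂⟩ : ∃ k₂ : ℕ, ∀ k ≥ k₂, ((2 : ℝ) ^ k) ^ (-(κ + (d - 1))) ≤ 1 / 2 := by
    have h1 : Tendsto (fun k : ℕ => ((2 : ℝ) ^ k) ^ (-(κ + ((d : ℝ) - 1)))) atTop (nhds 0) :=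
      (tendsto_rpow_neg_atTop (by
        have : (1 : ℝ) ≤ d := by exact_mod_cast hd
        linarith)).comp (tendsto_pow_atTop_atTop_of_one_lt one_lt_two)
    exact eventually_atTop.1 (h1.eventually (eventually_le_nhds (by norm_num)))
  set K := max k₁ k₂ with hK
  set ρ : ℝ := (2 : ℝ) ^ (-((n : ℝ) - d - κ)) with hρ
  have hρ0 : 0 ≤ ρ := by positivity
  have hρ1 : ρ < 1 := Real.rpow_lt_one_of_one_lt_of_neg one_lt_two (by linarith)
  have hn : 1 ≤ n := (Nat.zero_le _).trans_lt i0.2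
  set G : ℕ → Set (Fin n → UnitAddCircle) := fun k => {b | ¬ ∃ v : Fin n → ℤ,
        |P (intVec v + Pi.single i0 (intVec v ⬝ᵥ shearVec i0 b)) - ξ| ≤ C * ((2 : ℝ) ^ k) ^ (-κ) ∧
        ∀ i, |(v i : ℝ)| ≤ C * (2 : ℝ) ^ k} with hG
  have hGk : ∀ k ≥ K, volume (G k) ≤ ENNReal.ofReal (A * ρ ^ k) := by
    intro k hk
    set T : ℝ := (2 : ℝ) ^ k with hT
    have hT0 : 0 < T := by positivity
    have h := hmeas T (hk₁.le.trans (pow_le_pow_right₀ one_le_two ((le_max_left _ _).trans hk)))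
      (T ^ (-(κ + ((d : ℝ) - 1)))) (by positivity) (hk₂ k ((le_max_right _ _).trans hk))
    have e1 : T ^ (d - 1) * T ^ (-(κ + ((d : ℝ) - 1))) = T ^ (-κ) := by
      rw [← Real.rpow_natCast, ← Real.rpow_add hT0, Nat.cast_sub hd]
      congr 1; push_cast; ring
    have e2 : A / (T ^ (n - 1) * T ^ (-(κ + ((d : ℝ) - 1)))) = A * ρ ^ k := by
      rw [← Real.rpow_natCast, ← Real.rpow_add hT0, Nat.cast_sub hn, div_eq_mul_inv,
        ← Real.rpow_neg hT0.le, hρ, hT, ← Real.rpow_natCast 2 k, ← Real.rpow_mul (by norm_num),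
        ← Real.rpow_natCast _ k, ← Real.rpow_mul (by norm_num)]
      congr 2; push_cast; ring
    rw [e1, e2] at h
    exact h
  have hsum : ∑' k, volume (G (k + K)) ≠ ⊤ := by
    have hs : Summable fun k : ℕ => |A| * ρ ^ (k + K) := by
      simp_rw [pow_add, ← mul_assoc]
      exact ((summable_geometric_of_lt_one hρ0 hρ1).mul_left _).mul_right _
    refine ne_top_of_le_ne_top hs.tsum_ofReal_ne_top (ENNReal.tsum_le_tsum fun k => ?_)
    refine (hGk (k + K) (by omega)).trans (ENNReal.ofReal_le_ofReal ?_)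
    exact mul_le_mul_of_nonneg_right (le_abs_self A) (by positivity)
  filter_upwards [ae_eventually_notMem hsum] with b hb
  obtain ⟨k₃, hk₃⟩ := eventually_atTop.1 hb
  refine ⟨C, k₃ + K, fun k hk => ?_⟩
  have := hk₃ (k - K) (by omega)
  rw [Nat.sub_add_cancel (by omega)] at this
  exact not_not.1 this

/-- The sign of the `i`-th monomial of `F0`. -/
def blockSign (p : ℕ) {n : ℕ} (i : Fin n) : ℝ := if (i : ℕ) < p then 1 else -1

lemma F0_single {p q d : ℕ} (hd : d ≠ 0) (a : Fin (p + q)) (x : ℝ) :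
    F0 p q d (Pi.single a x) = blockSign p a * x ^ d := by
  rw [F0, Finset.sum_eq_single a]
  · simp [blockSign]
  · intro b _ hb; simp [hb, hd]
  · simp

lemma F0_sub_single {p q d : ℕ} (hd : d ≠ 0) (u : Fin (p + q) → ℝ) (a : Fin (p + q)) :
    F0 p q d (u - Pi.single a (u a)) = F0 p q d u - blockSign p a * u a ^ d := by
  rw [eq_sub_iff_add_eq, ← eq_sub_iff_add_eq', F0, F0, ← Finset.sum_sub_distrib,
    Finset.sum_eq_single a]
  · simp [blockSign, hd]
  · intro b _ hb; simp [hb]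
  · simp

lemma F0_contDiff (p q d : ℕ) : ContDiff ℝ 1 (F0 p q d) := by
  unfold F0; fun_prop

lemma F0_smul (p q d : ℕ) (t : ℝ) (x : Fin (p + q) → ℝ) :
    F0 p q d (t • x) = t ^ d * F0 p q d x := by
  simp only [F0, Pi.smul_apply, smul_eq_mul, mul_pow, Finset.mul_sum]
  exact Finset.sum_congr rfl fun i _ => by ring

lemma F0_neg {p q d : ℕ} (hd : Even d) (x : Fin (p + q) → ℝ) : F0 p q d (-x) = F0 p q d x := by
  simp [F0, hd.neg_pow]

lemma F0_exists_sign_change {p q d : ℕ} (hp : 1 ≤ p) (hq : 1 ≤ q) (hd : Even d) (hd0 : d ≠ 0)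
    {ρ : Fin (p + q) → ℝ} (hρ : ρ ≠ 0) :
    ∃ (u : Fin (p + q) → ℝ) (s : ℝ), 0 < F0 p q d u ∧ F0 p q d (u + s • ρ) < 0 := by
  have hcont : ∀ a : Fin (p + q), Continuous fun ε : ℝ => F0 p q d (ρ + Pi.single a ε) := fun a =>
    (F0_contDiff p q d).continuous.comp
      (continuous_const.add (continuous_single (A := fun _ => ℝ) a))
  have hne : {0}ᶜ ∈ nhdsWithin (0 : ℝ) {0}ᶜ := self_mem_nhdsWithin
  rcases lt_trichotomy (F0 p q d ρ) 0 with h | h | h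
  · set a : Fin (p + q) := ⟨0, by omega⟩
    have e : ∀ᶠ ε in nhds (0 : ℝ), F0 p q d (ρ + Pi.single a ε) < 0 :=
      ((hcont a).tendsto' 0 (F0 p q d ρ) (by simp)).eventually (gt_mem_nhds h)
    obtain ⟨ε, h1, h2⟩ := ((e.filter_mono nhdsWithin_le_nhds).and hne).exists
    refine ⟨Pi.single a ε, 1, ?_, by rwa [one_smul, add_comm]⟩
    rw [F0_single hd0, blockSign, if_pos (by simp [a]; omega), one_mul]
    exact hd.pow_pos h2
  · obtain ⟨a, ha⟩ := Function.ne_iff.1 hρ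
    have ha : 0 < ρ a ^ d := hd.pow_pos ha
    have h1 : F0 p q d (-Pi.single a (ρ a)) = blockSign p a * ρ a ^ d := by
      rw [F0_neg hd, F0_single hd0]
    have h2 := F0_sub_single (p := p) (q := q) hd0 ρ a
    rw [h, zero_sub] at h2
    by_cases hap : (a : ℕ) < p
    · rw [blockSign, if_pos hap, one_mul] at h1 h2
      refine ⟨-Pi.single a (ρ a), 1, by rwa [h1], ?_⟩
      rw [one_smul, neg_add_eq_sub, h2]
      linarith
    · rw [blockSign, if_neg hap] at h1 h2
      refine ⟨ρ - Pi.single a (ρ a), -1, by rw [h2]; linarith, ?_⟩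
      rw [show ρ - Pi.single a (ρ a) + (-1 : ℝ) • ρ = -Pi.single a (ρ a) by
        rw [neg_one_smul]; abel, h1]
      linarith
  · set a : Fin (p + q) := ⟨p, by omega⟩
    have e : ∀ᶠ ε in nhds (0 : ℝ), 0 < F0 p q d (ρ + Pi.single a ε) :=
      ((hcont a).tendsto' 0 (F0 p q d ρ) (by simp)).eventually (lt_mem_nhds h)
    obtain ⟨ε, h1, h2⟩ := ((e.filter_mono nhdsWithin_le_nhds).and hne).exists
    refine ⟨ρ + Pi.single a ε, -1, h1, ?_⟩
    rw [show ρ + Pi.single a ε + (-1 : ℝ) • ρ = Pi.single a ε by rw [neg_one_smul]; abel,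
      F0_single hd0, blockSign, if_neg (by simp [a])]
    have : 0 < ε ^ d := hd.pow_pos h2
    linarith

lemma Fg_exists_sign_change {p q d : ℕ} (hp : 1 ≤ p) (hq : 1 ≤ q) (hd : Even d) (hd0 : d ≠ 0)
    (g : SLR (p + q)) (i0 : Fin (p + q)) :
    ∃ (y : Fin (p + q) → ℝ) (s : ℝ), 0 < Fg p q d g y ∧ Fg p q d g (y + Pi.single i0 s) < 0 := by
  have hdet : IsUnit (g : Matrix (Fin (p + q)) (Fin (p + q)) ℝ).det := by
    rw [g.det_coe]; exact isUnit_one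
  set ρ := Matrix.vecMul (Pi.single i0 (1 : ℝ)) (g : Matrix (Fin (p + q)) (Fin (p + q)) ℝ) with hρ
  have hρ0 : ρ ≠ 0 := by
    intro h
    have h0 : Pi.single i0 (1 : ℝ) = (0 : Fin (p + q) → ℝ) :=
      Matrix.vecMul_injective_of_isUnit ((Matrix.isUnit_iff_isUnit_det _).2 hdet) (by
        simpa [hρ] using h)
    simpa using congrFun h0 i0
  obtain ⟨u, s, h1, h2⟩ := F0_exists_sign_change hp hq hd hd0 hρ0
  have hu : Matrix.vecMul (Matrix.vecMul u (g : Matrix (Fin (p + q)) (Fin (p + q)) ℝ)⁻¹)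
      (g : Matrix (Fin (p + q)) (Fin (p + q)) ℝ) = u := by
    rw [Matrix.vecMul_vecMul, Matrix.nonsing_inv_mul _ hdet, Matrix.vecMul_one]
  refine ⟨Matrix.vecMul u (g : Matrix (Fin (p + q)) (Fin (p + q)) ℝ)⁻¹, s, by rwa [Fg, hu], ?_⟩
  have hs : (Pi.single i0 s : Fin (p + q) → ℝ) = s • Pi.single i0 (1 : ℝ) := by
    rw [← Pi.single_smul, smul_eq_mul, mul_one]
  rwa [Fg, Matrix.add_vecMul, hu, hs, Matrix.smul_vecMul, ← hρ]

lemma Fg_contDiff (p q d : ℕ) (g : SLR (p + q)) : ContDiff ℝ 1 (Fg p q d g) := by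
  refine (F0_contDiff p q d).comp (contDiff_pi.2 fun j => ?_)
  simp only [Matrix.vecMul, dotProduct]
  fun_prop

lemma Fg_smul (p q d : ℕ) (g : SLR (p + q)) (t : ℝ) (x : Fin (p + q) → ℝ) :
    Fg p q d g (t • x) = t ^ d * Fg p q d g x := by
  rw [Fg, Matrix.smul_vecMul, F0_smul, Fg]

lemma Fg_neg {p q d : ℕ} (hd : Even d) (g : SLR (p + q)) (x : Fin (p + q) → ℝ) :
    Fg p q d g (-x) = Fg p q d g x := by
  rw [Fg, Matrix.neg_vecMul, F0_neg hd, Fg]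

/-- The unipotent matrix `1 + aᵀ e_{i0}`, where `a` is the vector of lifts of `b` with the
coordinate `i0` replaced by `0`. -/
def shear {n : ℕ} (i0 : Fin n) (b : Fin n → UnitAddCircle) : SLR n :=
  ⟨1 + Matrix.vecMulVec (shearVec i0 b) (Pi.single i0 1), by
    rw [Matrix.vecMulVec_eq Unit, Matrix.det_one_add_replicateCol_mul_replicateRow]
    simp [shearVec]⟩

lemma vecMul_shear {n : ℕ} (i0 : Fin n) (b : Fin n → UnitAddCircle) (v : Fin n → ℝ) :
    Matrix.vecMul v (shear i0 b : Matrix (Fin n) (Fin n) ℝ)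
      = v + Pi.single i0 (v ⬝ᵥ shearVec i0 b) := by
  change Matrix.vecMul v (1 + Matrix.vecMulVec (shearVec i0 b) (Pi.single i0 1)) = _
  rw [Matrix.vecMul_add, Matrix.vecMul_one, Matrix.vecMul_vecMulVec]
  congr 1
  ext i
  by_cases hi : i = i0
  · subst hi; simp
  · simp [hi]

lemma Fg_shear_mul (p q d : ℕ) (i0 : Fin (p + q)) (b : Fin (p + q) → UnitAddCircle)
    (g : SLR (p + q)) (v : Fin (p + q) → ℝ) :
    Fg p q d (shear i0 b * g) v = Fg p q d g (v + Pi.single i0 (v ⬝ᵥ shearVec i0 b)) := by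
  rw [Fg, Fg, ← vecMul_shear, Matrix.vecMul_vecMul, Matrix.SpecialLinearGroup.coe_mul]

instance (n : ℕ) : BorelSpace (SLR n) := ⟨rfl⟩

instance (n : ℕ) : ContinuousMul (SLR n) :=
  (Matrix.SpecialLinearGroup.topologicalGroup (n := Fin n) (R := ℝ)).toContinuousMul

instance (n : ℕ) : SigmaCompactSpace (SLR n) :=
  have : SigmaCompactSpace (Matrix (Fin n) (Fin n) ℝ) :=
    inferInstanceAs (SigmaCompactSpace (Fin n → Fin n → ℝ))
  (Matrix.SpecialLinearGroup.isClosedEmbedding_val (n := Fin n) (R := ℝ)).sigmaCompactSpace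

lemma measurable_SLR_entry {n : ℕ} (i j : Fin n) :
    Measurable fun g : SLR n => (g : Matrix (Fin n) (Fin n) ℝ) i j :=
  (Continuous.matrix_elem continuous_induced_dom i j).measurable

lemma measurable_Fg_shear_mul {p q d : ℕ} (i0 : Fin (p + q)) (v : Fin (p + q) → ℝ) :
    Measurable fun x : SLR (p + q) × (Fin (p + q) → UnitAddCircle) =>
      Fg p q d (shear i0 x.2 * x.1) v := by
  simp_rw [Fg_shear_mul]
  unfold Fg F0
  refine Finset.measurable_fun_sum _ fun j _ => Measurable.const_mul (Measurable.pow_const ?_ _) _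
  simp only [Matrix.vecMul, dotProduct]
  refine Finset.measurable_fun_sum _ fun i _ => Measurable.mul ?_
    ((measurable_SLR_entry i j).comp measurable_fst)
  simp only [Pi.add_apply]
  refine measurable_const.add ?_
  have hm : Measurable fun x : SLR (p + q) × (Fin (p + q) → UnitAddCircle) =>
      ∑ l, v l * shearVec i0 x.2 l := by
    refine Finset.measurable_fun_sum _ fun l _ => Measurable.const_mul ?_ _
    unfold shearVec
    split_ifs
    · exact measurable_const
    · exact measurable_circleLift.comp ((measurable_pi_apply l).comp measurable_snd)
  by_cases hi : i = i0
  · subst hi; simpa using hm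
  · simp [hi]

/-- `g·F₀` takes values close to `ξ` at all large dyadic scales, with exponent `κ`. -/
def DyadicApprox (p q d : ℕ) (κ ξ : ℝ) (g : SLR (p + q)) : Prop :=
  ∃ C k₀ : ℕ, ∀ k ≥ k₀, ∃ v : Fin (p + q) → ℤ,
    |Fg p q d g (intVec v) - ξ| ≤ C * ((2 : ℝ) ^ k) ^ (-κ) ∧
    ∀ i, |(v i : ℝ)| ≤ C * (2 : ℝ) ^ k

lemma measurableSet_dyadicApprox_shear {p q d : ℕ} (κ ξ : ℝ) (i0 : Fin (p + q)) :
    MeasurableSet {x : SLR (p + q) × (Fin (p + q) → UnitAddCircle) |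
      DyadicApprox p q d κ ξ (shear i0 x.2 * x.1)} := by
  unfold DyadicApprox
  refine measurableSet_setOfPred.2 (Measurable.exists fun C => Measurable.exists fun k₀ =>
    Measurable.forall fun k => Measurable.imp measurable_const (Measurable.exists fun v =>
      Measurable.and ?_ measurable_const))
  exact measurableSet_setOfPred.1 (measurableSet_le
    (continuous_abs.measurable.comp ((measurable_Fg_shear_mul i0 (intVec v)).sub_const ξ))
    measurable_const)

lemma eucNorm_intVec_le {n : ℕ} (v : Fin n → ℤ) {B : ℝ} (hB : ∀ i, |(v i : ℝ)| ≤ B) :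
    eucNorm (intVec v) ≤ n * B := by
  have hs : ∑ i : Fin n, B = n * B := by simp
  have h0 : 0 ≤ ∑ i : Fin n, B := Finset.sum_nonneg fun i _ => (abs_nonneg _).trans (hB i)
  rw [eucNorm, ← hs]
  refine Real.sqrt_le_iff.2 ⟨h0, ?_⟩
  calc ∑ i, intVec v i ^ 2 = ∑ i, |(v i : ℝ)| ^ 2 := by simp [intVec]
    _ ≤ (∑ i, |(v i : ℝ)|) ^ 2 := Finset.sum_sq_le_sq_sum_of_nonneg fun i _ => abs_nonneg _
    _ ≤ _ := by
      gcongr with i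
      exact hB i

lemma DyadicApprox.eventually_exists {p q d : ℕ} {κ κ' ξ : ℝ} (hκ : κ < κ') (hκ0 : 0 < κ')
    {g : SLR (p + q)} (h : DyadicApprox p q d κ' ξ g) :
    ∃ t₀ : ℝ, ∀ t ≥ t₀, ∃ v : Fin (p + q) → ℤ,
      |Fg p q d g (intVec v) - ξ| < t ^ (-κ) ∧ eucNorm (intVec v) ≤ t := by
  obtain ⟨C, k₀, h⟩ := h
  set A : ℝ := ((p + q : ℕ) : ℝ) * C + 1 with hA
  have hA1 : 1 ≤ A := by
    have : (0 : ℝ) ≤ ((p + q : ℕ) : ℝ) * C := by positivity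
    linarith
  have hA0 : 0 < A := by linarith
  obtain ⟨t₁, ht₁⟩ := eventually_atTop.1
    ((tendsto_rpow_atTop (sub_pos.2 hκ)).eventually_gt_atTop (C * (2 * A) ^ κ'))
  refine ⟨max t₁ (A * 2 ^ k₀), fun t ht => ?_⟩
  have ht1 : t₁ ≤ t := (le_max_left _ _).trans ht
  have ht2 : (2 : ℝ) ^ k₀ ≤ t / A := by
    rw [le_div_iff₀ hA0, mul_comm]; exact (le_max_right _ _).trans ht
  have h1k : (1 : ℝ) ≤ 2 ^ k₀ := one_le_pow₀ one_le_two
  have ht0 : 0 < t := by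
    have : 0 < t / A := by linarith
    exact (div_pos_iff_of_pos_right hA0).1 this
  obtain ⟨k, hk1, hk2⟩ := exists_nat_pow_near (h1k.trans ht2) (one_lt_two (α := ℝ))
  have hk : k₀ ≤ k := by
    by_contra hlt
    have := pow_le_pow_right₀ (one_le_two (α := ℝ)) (show k + 1 ≤ k₀ by omega)
    linarith
  obtain ⟨v, hv1, hv2⟩ := h k hk
  have hAk : A * 2 ^ k ≤ t := by rw [le_div_iff₀ hA0] at hk1; linarith
  refine ⟨v, hv1.trans_lt ?_, ?_⟩
  · have hlow : t / (2 * A) ≤ (2 : ℝ) ^ k := by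
      rw [div_lt_iff₀ hA0, pow_succ] at hk2
      rw [div_le_iff₀ (by positivity)]
      linarith
    calc (C : ℝ) * ((2 : ℝ) ^ k) ^ (-κ') ≤ C * (t / (2 * A)) ^ (-κ') :=
          mul_le_mul_of_nonneg_left
            (Real.rpow_le_rpow_of_nonpos (by positivity) hlow (by linarith)) (by positivity)
      _ = C * (2 * A) ^ κ' * t ^ (-κ') := by
          rw [Real.div_rpow ht0.le (by positivity), Real.rpow_neg (x := 2 * A) (by positivity),
            div_inv_eq_mul]
          ring
      _ < t ^ (κ' - κ) * t ^ (-κ') :=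
          mul_lt_mul_of_pos_right (ht₁ t ht1) (Real.rpow_pos_of_pos ht0 _)
      _ = t ^ (-κ) := by rw [← Real.rpow_add ht0]; congr 1; ring
  · refine (eucNorm_intVec_le v hv2).trans (le_trans ?_ hAk)
    have : (0 : ℝ) < 2 ^ k := by positivity
    rw [hA]
    nlinarith

lemma ae_dyadicApprox {p q d : ℕ} (hp : 1 ≤ p) (hq : 1 ≤ q) (hd2 : 2 ≤ d) (hdeven : Even d)
    (hnd : d < p + q) {κ : ℝ} (hκ0 : 0 < κ) (hκ : κ < (p + q : ℝ) - d) (ξ : ℝ)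
    (μ : Measure (SLR (p + q))) [μ.IsHaarMeasure] : ∀ᵐ g ∂μ, DyadicApprox p q d κ ξ g := by
  set i0 : Fin (p + q) := ⟨0, by omega⟩
  set i1 : Fin (p + q) := ⟨1, by omega⟩
  set i2 : Fin (p + q) := ⟨2, by omega⟩
  have hfib : ∀ g : SLR (p + q), ∀ᵐ b : Fin (p + q) → UnitAddCircle,
      DyadicApprox p q d κ ξ (shear i0 b * g) := by
    intro g
    obtain ⟨y, s, hy, hys⟩ := Fg_exists_sign_change hp hq hdeven (by omega : d ≠ 0) g i0
    have := ae_forall_dyadic_approximable (n := p + q) (d := d) (i0 := i0) (i1 := i1) (i2 := i2)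
      (by simp [i0, i1]) (by simp [i0, i2]) (by simp [i1, i2]) (by omega)
      (Fg_contDiff p q d g) (Fg_smul p q d g) (Fg_neg hdeven g) hy hys ξ hκ0
      (by push_cast; exact hκ)
    simpa only [DyadicApprox, Fg_shear_mul] using this
  obtain ⟨b, hb⟩ := ((Measure.ae_ae_comm (measurableSet_dyadicApprox_shear κ ξ i0)).1
    (ae_of_all μ hfib)).exists
  have hpre : (fun g => shear i0 b * g) ⁻¹' {g | ¬ DyadicApprox p q d κ ξ g}
      = {g | ¬ DyadicApprox p q d κ ξ (shear i0 b * g)} := rfl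
  rw [ae_iff, ← measure_preimage_mul μ (shear i0 b), hpre]
  exact ae_iff.1 hb

/-- For any `0 < κ < n − d` and any `ξ ∈ ℝ`, for almost all `F ∈ Y_{p,q}^{(d)}` the system
`|F(v) − ξ| < t^{−κ}`, `‖v‖ ≤ t` has an integer solution for all sufficiently large `t`. -/
theorem generic_effective_density
    (p q d : ℕ) (hp : 1 ≤ p) (hq : 1 ≤ q) (hd2 : 2 ≤ d) (hdeven : Even d)
    (hnd : d < p + q)
    (κ : ℝ) (hκ0 : 0 < κ) (hκ : κ < (p + q : ℝ) - d) (ξ : ℝ)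
    (μ : Measure (SLR (p + q))) [μ.IsHaarMeasure] :
    ∀ᵐ g ∂μ, ∃ t₀ : ℝ, ∀ t ≥ t₀, ∃ v : Fin (p + q) → ℤ,
      |Fg p q d g (intVec v) - ξ| < t ^ (-κ) ∧ eucNorm (intVec v) ≤ t := by
  have h1 : κ < (κ + ((p + q : ℝ) - d)) / 2 := by linarith
  filter_upwards [ae_dyadicApprox hp hq hd2 hdeven hnd
    (κ := (κ + ((p + q : ℝ) - d)) / 2) (by linarith) (by linarith) ξ μ] with g hg
  exact hg.eventually_exists h1 (by linarith)

end
end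

section
/- Let n ≥ 3 and let μ be a Haar measure on G = SL_n(ℝ). Then there exist constants 0 < c₁ ≤ c₂ (depending only on n and the normalization of μ) such that for all 0 < ε ≤ 1: c₁·ε^{d_n} ≤ μ(O_ε) ≤ c₂·ε^{d_n}, where d_n = (n+2)(n−1)/2 and O_ε = {g ∈ SL_n(ℝ) : ‖g‖ < 1 + ε}. -/
open MeasureTheory Matrix

noncomputable section

/-- The operator norm `‖g‖_op = sup{‖vg‖ : ‖v‖ = 1}` (row vectors, right action). -/
def opNorm {n : ℕ} (g : SLR n) : ℝ :=
  sSup {r : ℝ | ∃ v : Fin n → ℝ, eucNorm v = 1 ∧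
    r = eucNorm (Matrix.vecMul v (g : Matrix (Fin n) (Fin n) ℝ))}

/-- The symmetric norm `‖g‖ = max{‖g‖_op, ‖g⁻¹‖_op}`. -/
def gNorm {n : ℕ} (g : SLR n) : ℝ := max (opNorm g) (opNorm g⁻¹)

/-- The norm ball `O_ε = {g ∈ SL_n(ℝ) : ‖g‖ < 1 + ε}`. -/
def Oball (n : ℕ) (ε : ℝ) : Set (SLR n) := {g | gNorm g < 1 + ε}

/-- `d_n = (n+2)(n−1)/2`. -/
def dn (n : ℕ) : ℕ := (n + 2) * (n - 1) / 2

instance inst_s5 (n : ℕ) : BorelSpace (SLR n) := ⟨rfl⟩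

instance (n : ℕ) : IsTopologicalGroup (SLR n) :=
  Matrix.SpecialLinearGroup.topologicalGroup

lemma abs_mul_apply_le {n : ℕ} {A B : Matrix (Fin n) (Fin n) ℝ} {a b : ℝ} (ha : 0 ≤ a)
    (hA : ∀ i j, |A i j| ≤ a) (hB : ∀ i j, |B i j| ≤ b) (i j : Fin n) :
    |(A * B) i j| ≤ n * a * b := by
  rw [Matrix.mul_apply]
  calc |∑ k, A i k * B k j| ≤ ∑ k, |A i k * B k j| := Finset.abs_sum_le_sum_abs _ _
    _ ≤ ∑ _k : Fin n, a * b := by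
        refine Finset.sum_le_sum fun k _ => ?_
        rw [abs_mul]
        exact mul_le_mul (hA i k) (hB k j) (abs_nonneg _) ha
    _ = n * a * b := by simp [mul_assoc]

/-- A Lipschitz bound for the determinant on matrices with bounded entries. -/
lemma exists_abs_det_sub_le (n : ℕ) (R : ℝ) :
    ∃ L : ℝ, 0 ≤ L ∧ ∀ (A B : Matrix (Fin n) (Fin n) ℝ) (η : ℝ), 0 ≤ η →
      (∀ i j, |A i j| ≤ R) → (∀ i j, |B i j| ≤ R) → (∀ i j, |A i j - B i j| ≤ η) →
      |A.det - B.det| ≤ L * η := by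
  let f : (Fin n → Fin n → ℝ) → ℝ := fun x => (Matrix.of x).det
  have hf : ContDiff ℝ 1 f := by
    simp only [f, Matrix.det_apply, Matrix.of_apply]
    fun_prop
  have hc : IsCompact (Metric.closedBall (0 : Fin n → Fin n → ℝ) (max R 0)) :=
    isCompact_closedBall _ _
  obtain ⟨K, hK⟩ := LocallyLipschitzOn.exists_lipschitzOnWith_of_compact hc
    (hf.locallyLipschitz.locallyLipschitzOn (s := Metric.closedBall 0 (max R 0)))
  have hmem : ∀ A : Matrix (Fin n) (Fin n) ℝ, (∀ i j, |A i j| ≤ R) →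
      (fun i j => A i j) ∈ Metric.closedBall (0 : Fin n → Fin n → ℝ) (max R 0) := by
    intro A hA
    rw [mem_closedBall_zero_iff, pi_norm_le_iff_of_nonneg (le_max_right _ _)]
    intro i
    rw [pi_norm_le_iff_of_nonneg (le_max_right _ _)]
    exact fun j => (hA i j).trans (le_max_left _ _)
  refine ⟨K, K.2, fun A B η hη hA hB hAB => ?_⟩
  have h := hK.dist_le_mul _ (hmem A hA) _ (hmem B hB)
  have hd : dist (fun i j => A i j) (fun i j => B i j) ≤ η := by
    refine (dist_pi_le_iff hη).2 fun i => (dist_pi_le_iff hη).2 fun j => ?_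
    simpa [Real.dist_eq] using hAB i j
  exact h.trans (mul_le_mul_of_nonneg_left hd K.2)

/-- Positions of the coordinates used on the space of Gram matrices of determinant one. -/
abbrev UpperIndex (n : ℕ) := {p : Fin n × Fin n // p.1 ≤ p.2 ∧ (p.1 : ℕ) + 1 < n}

lemma card_upperIndex (n : ℕ) : Fintype.card (UpperIndex n) = dn n := by
  rcases n with _ | m
  · rfl
  have h1 : Fintype.card (UpperIndex (m + 1)) =
      ∑ i : Fin (m + 1), if (i : ℕ) < m then m + 1 - (i : ℕ) else 0 := by
    rw [Fintype.card_subtype, Finset.card_filter, ← Finset.univ_product_univ,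
      Finset.sum_product]
    refine Finset.sum_congr rfl fun i _ => ?_
    split_ifs with h
    · simp only [add_lt_add_iff_right, h, and_true]
      rw [← Finset.card_filter, ← Fin.card_Ici]
      congr 1
      ext; simp
    · simp [h]
  rw [h1, Fin.sum_univ_castSucc]
  simp only [Fin.val_castSucc, Fin.is_lt, if_true, Fin.val_last, lt_irrefl, if_false, add_zero]
  rw [Fin.sum_univ_eq_sum_range (fun i => m + 1 - i) m]
  have h2 : ∀ k, 2 * ∑ i ∈ Finset.range k, (k + 1 - i) = (k + 3) * k := by
    intro k
    induction k with
    | zero => simp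
    | succ k ih =>
      rw [Finset.sum_range_succ']
      simp only [Nat.add_sub_add_right]
      rw [mul_add, ih]
      simp only [Nat.sub_zero]
      ring
  simp only [dn, Nat.add_sub_cancel]
  have := h2 m
  have e : m + 1 + 2 = m + 3 := by ring
  rw [e]
  omega

lemma abs_inv_apply_le {n : ℕ} {R : ℝ} (g : SLR n) (hg : ∀ i j, |g i j| ≤ R) (i j : Fin n) :
    |g⁻¹ i j| ≤ (Fintype.card (Fin n)).factorial • (max R 1) ^ Fintype.card (Fin n) := by
  rw [Matrix.SpecialLinearGroup.coe_inv, Matrix.adjugate_apply]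
  refine Matrix.det_le (abv := AbsoluteValue.abs) fun k l => ?_
  simp only [AbsoluteValue.abs_apply, Matrix.updateRow_apply]
  split_ifs
  · by_cases h : l = i
    · subst h; simp
    · simp [h]
  · exact (hg k l).trans (le_max_left _ _)

lemma coe_mul_coe_inv {n : ℕ} (g : SLR n) :
    (g : Matrix (Fin n) (Fin n) ℝ) * (g⁻¹ : SLR n) = 1 := by
  rw [← Matrix.SpecialLinearGroup.coe_mul, mul_inv_cancel, Matrix.SpecialLinearGroup.coe_one]

lemma coe_inv_mul_coe {n : ℕ} (g : SLR n) :
    ((g⁻¹ : SLR n) : Matrix (Fin n) (Fin n) ℝ) * g = 1 := by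
  rw [← Matrix.SpecialLinearGroup.coe_mul, inv_mul_cancel, Matrix.SpecialLinearGroup.coe_one]

/-- Elements of `SL_n(ℝ)` with bounded entries, together with their inverses. -/
def entryBox (n : ℕ) : Set (SLR n) := {g | ∀ i j, |g i j| < 2 ∧ |g⁻¹ i j| < 2}

/-- Gram matrices of determinant one are Lipschitz functions of their upper coordinates. -/
lemma exists_abs_gram_sub_le (n : ℕ) (hn : 1 ≤ n) :
    ∃ C : ℝ, 0 < C ∧ ∀ g ∈ entryBox n, ∀ h ∈ entryBox n, ∀ η : ℝ, 0 ≤ η →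
      (∀ p : UpperIndex n, |((g : Matrix (Fin n) (Fin n) ℝ) * (g : Matrix (Fin n) (Fin n) ℝ)ᵀ) p.1.1 p.1.2
        - ((h : Matrix (Fin n) (Fin n) ℝ) * (h : Matrix (Fin n) (Fin n) ℝ)ᵀ) p.1.1 p.1.2| ≤ η) →
      ∀ i j, |((g : Matrix (Fin n) (Fin n) ℝ) * (g : Matrix (Fin n) (Fin n) ℝ)ᵀ) i j
        - ((h : Matrix (Fin n) (Fin n) ℝ) * (h : Matrix (Fin n) (Fin n) ℝ)ᵀ) i j| ≤ C * η := by
  obtain ⟨L, hL0, hL⟩ := exists_abs_det_sub_le n (n * 2 * 2)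
  have hn' : (1 : ℝ) ≤ n := by exact_mod_cast hn
  refine ⟨max 1 (L * (4 * n)), by positivity, fun g hg h hh η hη hp => ?_⟩
  let l : Fin n := ⟨n - 1, by omega⟩
  set G : Matrix (Fin n) (Fin n) ℝ := (g : Matrix (Fin n) (Fin n) ℝ) with hG
  set H : Matrix (Fin n) (Fin n) ℝ := (h : Matrix (Fin n) (Fin n) ℝ) with hH
  have hsymm : ∀ (M : Matrix (Fin n) (Fin n) ℝ) i j, (M * Mᵀ) i j = (M * Mᵀ) j i := by
    intro M i j
    simp only [Matrix.mul_apply, Matrix.transpose_apply]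
    exact Finset.sum_congr rfl fun k _ => mul_comm _ _
  have hoff : ∀ i j, ¬ (i = l ∧ j = l) → |(G * Gᵀ) i j - (H * Hᵀ) i j| ≤ η := by
    intro i j hij
    have hil : ∀ k : Fin n, k ≠ l → (k : ℕ) + 1 < n := by
      intro k hk
      have : (k : ℕ) ≠ n - 1 := fun e => hk (Fin.ext e)
      omega
    have hle : ∀ k : Fin n, k ≤ l := fun k => Fin.le_def.2 (by simp only [l]; omega)
    rcases le_total i j with hle' | hle'
    · refine hp ⟨(i, j), hle', hil i ?_⟩
      rintro rfl
      exact hij ⟨rfl, le_antisymm (hle j) hle'⟩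
    · rw [hsymm G i j, hsymm H i j]
      refine hp ⟨(j, i), hle', hil j ?_⟩
      rintro rfl
      exact hij ⟨le_antisymm (hle i) hle', rfl⟩
  have hGb : ∀ i j, |(G * Gᵀ) i j| ≤ n * 2 * 2 :=
    abs_mul_apply_le (by norm_num) (fun i j => (hg i j).1.le) (fun i j => (hg j i).1.le)
  have hHb : ∀ i j, |(H * Hᵀ) i j| ≤ n * 2 * 2 :=
    abs_mul_apply_le (by norm_num) (fun i j => (hh i j).1.le) (fun i j => (hh j i).1.le)
  have hGd : (G * Gᵀ).det = 1 := by simp [Matrix.det_mul, hG]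
  have hHd : (H * Hᵀ).det = 1 := by simp [Matrix.det_mul, hH]
  let x : ℝ := (H * Hᵀ) l l - (G * Gᵀ) l l
  let S' : Matrix (Fin n) (Fin n) ℝ :=
    (G * Gᵀ).updateRow l ((G * Gᵀ) l + x • Pi.single l 1)
  have hS'd : S'.det = 1 + x * (G * Gᵀ).adjugate l l := by
    simp only [S']
    rw [Matrix.det_updateRow_add, Matrix.det_updateRow_smul, Matrix.updateRow_eq_self, hGd,
      Matrix.adjugate_apply]
  have hS' : ∀ i j, S' i j = if i = l ∧ j = l then (H * Hᵀ) l l else (G * Gᵀ) i j := by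
    intro i j
    simp only [S', Matrix.updateRow_apply]
    by_cases hi : i = l
    · by_cases hj : j = l
      · subst hi; subst hj; simp [x]
      · simp [hi, hj]
    · simp [hi]
  have hadj : (G * Gᵀ).adjugate l l = ∑ k, (g⁻¹ k l) ^ 2 := by
    rw [Matrix.adjugate_mul_distrib, ← Matrix.adjugate_transpose, hG,
      ← Matrix.SpecialLinearGroup.coe_inv, Matrix.mul_apply]
    exact Finset.sum_congr rfl fun k _ => by rw [Matrix.transpose_apply, sq]
  have hlow : 1 ≤ 4 * n * (G * Gᵀ).adjugate l l := by
    have h1 : ∑ k, G l k * g⁻¹ k l = 1 := by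
      rw [← Matrix.mul_apply, hG, coe_mul_coe_inv]; simp
    have h2 := Finset.sum_mul_sq_le_sq_mul_sq Finset.univ (fun k => G l k) (fun k => g⁻¹ k l)
    rw [h1, ← hadj] at h2
    have h3 : ∑ k, G l k ^ 2 ≤ 4 * n := by
      calc ∑ k, G l k ^ 2 ≤ ∑ _k : Fin n, (4 : ℝ) := by
            refine Finset.sum_le_sum fun k _ => ?_
            have := abs_lt.1 (hg l k).1
            nlinarith
        _ = 4 * n := by simp [mul_comm]
    have h4 : 0 ≤ (G * Gᵀ).adjugate l l := by rw [hadj]; positivity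
    nlinarith [mul_le_mul_of_nonneg_right h3 h4]
  have hx : |x| ≤ L * (4 * n) * η := by
    have h1 := hL S' (H * Hᵀ) η hη
      (by intro i j; rw [hS']; split_ifs; exacts [hHb _ _, hGb _ _]) hHb
      (by
        intro i j
        rw [hS']
        split_ifs with hij
        · rw [hij.1, hij.2]; simpa using hη
        · exact hoff i j hij)
    rw [hS'd, hHd, add_sub_cancel_left, abs_mul] at h1
    have h4 : 0 ≤ (G * Gᵀ).adjugate l l := by rw [hadj]; positivity
    rw [abs_of_nonneg h4] at h1
    nlinarith [abs_nonneg x, mul_le_mul_of_nonneg_left hlow (abs_nonneg x)]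
  intro i j
  by_cases hij : i = l ∧ j = l
  · rw [hij.1, hij.2, abs_sub_comm]
    exact hx.trans (mul_le_mul_of_nonneg_right (le_max_right _ _) hη)
  · refine (hoff i j hij).trans ?_
    nlinarith [le_max_left (1 : ℝ) (L * (4 * n))]

/-- If two elements have close Gram matrices, their quotient is nearly orthogonal. -/
lemma exists_abs_gram_inv_mul_sub_one_le (n : ℕ) (hn : 1 ≤ n) :
    ∃ C : ℝ, 0 < C ∧ ∀ g ∈ entryBox n, ∀ h ∈ entryBox n, ∀ η : ℝ, 0 ≤ η →
      (∀ p : UpperIndex n, |((g : Matrix (Fin n) (Fin n) ℝ) * (g : Matrix (Fin n) (Fin n) ℝ)ᵀ) p.1.1 p.1.2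
        - ((h : Matrix (Fin n) (Fin n) ℝ) * (h : Matrix (Fin n) (Fin n) ℝ)ᵀ) p.1.1 p.1.2| ≤ η) →
      ∀ i j, |(((h⁻¹ * g : SLR n) : Matrix (Fin n) (Fin n) ℝ) *
        ((h⁻¹ * g : SLR n) : Matrix (Fin n) (Fin n) ℝ)ᵀ - 1) i j| ≤ C * η := by
  obtain ⟨C, hC, H⟩ := exists_abs_gram_sub_le n hn
  have hn' : (1 : ℝ) ≤ n := by exact_mod_cast hn
  refine ⟨n * 2 * (n * C * 2), by positivity, fun g hg h hh η hη hp i j => ?_⟩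
  have key : ((h⁻¹ * g : SLR n) : Matrix (Fin n) (Fin n) ℝ) *
        ((h⁻¹ * g : SLR n) : Matrix (Fin n) (Fin n) ℝ)ᵀ - 1 =
      ((h⁻¹ : SLR n) : Matrix (Fin n) (Fin n) ℝ) *
      (((g : Matrix (Fin n) (Fin n) ℝ) * (g : Matrix (Fin n) (Fin n) ℝ)ᵀ -
        (h : Matrix (Fin n) (Fin n) ℝ) * (h : Matrix (Fin n) (Fin n) ℝ)ᵀ) *
        ((h⁻¹ : SLR n) : Matrix (Fin n) (Fin n) ℝ)ᵀ) := by
    have e : ((h⁻¹ : SLR n) : Matrix (Fin n) (Fin n) ℝ) *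
        ((h : Matrix (Fin n) (Fin n) ℝ) * (h : Matrix (Fin n) (Fin n) ℝ)ᵀ *
        ((h⁻¹ : SLR n) : Matrix (Fin n) (Fin n) ℝ)ᵀ) = 1 := by
      rw [Matrix.mul_assoc, ← Matrix.transpose_mul, coe_inv_mul_coe, Matrix.transpose_one,
        Matrix.mul_one, coe_inv_mul_coe]
    rw [Matrix.sub_mul, Matrix.mul_sub, e, Matrix.SpecialLinearGroup.coe_mul,
      Matrix.transpose_mul]
    simp only [Matrix.mul_assoc]
  rw [key]
  have h1 := abs_mul_apply_le (by positivity) (H g hg h hh η hη hp)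
    (B := ((h⁻¹ : SLR n) : Matrix (Fin n) (Fin n) ℝ)ᵀ) (fun i j => (hh j i).2.le)
  have h2 := abs_mul_apply_le (by norm_num)
    (A := ((h⁻¹ : SLR n) : Matrix (Fin n) (Fin n) ℝ)) (fun i j => (hh i j).2.le) h1 i j
  refine h2.trans (le_of_eq ?_)
  ring

lemma eucNorm_nonneg {n : ℕ} (v : Fin n → ℝ) : 0 ≤ eucNorm v := Real.sqrt_nonneg _

lemma eucNorm_sq {n : ℕ} (v : Fin n → ℝ) : eucNorm v ^ 2 = v ⬝ᵥ v := by
  rw [eucNorm, Real.sq_sqrt (by positivity)]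
  exact Finset.sum_congr rfl fun i _ => sq _

lemma eucNorm_vecMul_sq {n : ℕ} (A : Matrix (Fin n) (Fin n) ℝ) (v : Fin n → ℝ) :
    eucNorm (v ᵥ* A) ^ 2 = eucNorm v ^ 2 + v ⬝ᵥ (A * Aᵀ - 1) *ᵥ v := by
  rw [eucNorm_sq, eucNorm_sq, Matrix.sub_mulVec, Matrix.one_mulVec, dotProduct_sub,
    ← Matrix.mulVec_mulVec, Matrix.dotProduct_mulVec, Matrix.mulVec_transpose]
  ring

lemma abs_dotProduct_mulVec_le {n : ℕ} {E : Matrix (Fin n) (Fin n) ℝ} {η : ℝ}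
    (hE : ∀ i j, |E i j| ≤ η) (v : Fin n → ℝ) :
    |v ⬝ᵥ E *ᵥ v| ≤ n * η * eucNorm v ^ 2 := by
  rw [eucNorm_sq]
  calc |v ⬝ᵥ E *ᵥ v| = |∑ i, ∑ j, v i * (E i j * v j)| := by
        simp only [dotProduct, Matrix.mulVec, Finset.mul_sum]
    _ ≤ ∑ i, ∑ j, |v i * (E i j * v j)| :=
        (Finset.abs_sum_le_sum_abs _ _).trans
          (Finset.sum_le_sum fun i _ => Finset.abs_sum_le_sum_abs _ _)
    _ ≤ ∑ i, ∑ j, η / 2 * (v i * v i + v j * v j) := by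
        refine Finset.sum_le_sum fun i _ => Finset.sum_le_sum fun j _ => ?_
        rw [abs_mul, abs_mul]
        have h1 : |v i| * |v j| ≤ (v i * v i + v j * v j) / 2 := by
          nlinarith [sq_nonneg (|v i| - |v j|), abs_mul_abs_self (v i), abs_mul_abs_self (v j)]
        have h2 := hE i j
        have h3 : 0 ≤ |v i| * |v j| := by positivity
        nlinarith [abs_nonneg (E i j)]
    _ = n * η * (v ⬝ᵥ v) := by
        simp only [← Finset.mul_sum, Finset.sum_add_distrib, Finset.sum_const, Finset.card_univ,
          Fintype.card_fin, nsmul_eq_mul, dotProduct]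
        rw [Finset.sum_congr rfl fun x _ => mul_left_comm (v x) (n : ℝ) (v x), ← Finset.mul_sum]
        ring

lemma eucNorm_le_of_gram {n : ℕ} {A : SLR n} {η : ℝ}
    (hA : ∀ i j, |((A : Matrix (Fin n) (Fin n) ℝ) * (A : Matrix (Fin n) (Fin n) ℝ)ᵀ - 1) i j| ≤ η)
    (v : Fin n → ℝ) :
    (1 - n * η) * eucNorm v ^ 2 ≤ eucNorm (v ᵥ* (A : Matrix (Fin n) (Fin n) ℝ)) ^ 2 ∧
    eucNorm (v ᵥ* (A : Matrix (Fin n) (Fin n) ℝ)) ^ 2 ≤ (1 + n * η) * eucNorm v ^ 2 := by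
  have h := abs_le.1 (abs_dotProduct_mulVec_le hA v)
  rw [eucNorm_vecMul_sq]
  constructor <;> linarith [h.1, h.2]

lemma exists_eucNorm_eq_one {n : ℕ} (hn : 1 ≤ n) : ∃ v : Fin n → ℝ, eucNorm v = 1 :=
  ⟨Pi.single ⟨0, hn⟩ 1, by
    rw [← sq_eq_sq₀ (eucNorm_nonneg _) zero_le_one, eucNorm_sq]; simp⟩

lemma opNorm_le {n : ℕ} (hn : 1 ≤ n) (g : SLR n) (c : ℝ)
    (h : ∀ v, eucNorm v = 1 → eucNorm (v ᵥ* (g : Matrix (Fin n) (Fin n) ℝ)) ≤ c) :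
    opNorm g ≤ c := by
  obtain ⟨v, hv⟩ := exists_eucNorm_eq_one hn
  refine csSup_le ⟨_, v, hv, rfl⟩ ?_
  rintro r ⟨w, hw, rfl⟩
  exact h w hw

lemma mem_Oball_of_gram {n : ℕ} (hn : 1 ≤ n) {A : SLR n} {η ε : ℝ} (hε : 0 < ε) (hε1 : ε ≤ 1)
    (hη : n * η ≤ ε / 2)
    (hA : ∀ i j, |((A : Matrix (Fin n) (Fin n) ℝ) * (A : Matrix (Fin n) (Fin n) ℝ)ᵀ - 1) i j| ≤ η) :
    A ∈ Oball n ε := by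
  have hs : √(1 + ε) < 1 + ε := by
    rw [Real.sqrt_lt' (by linarith)]; nlinarith
  refine max_lt (lt_of_le_of_lt (opNorm_le hn _ _ fun v hv => ?_) hs)
    (lt_of_le_of_lt (opNorm_le hn _ _ fun v hv => ?_) hs)
  · apply Real.le_sqrt_of_sq_le
    have := (eucNorm_le_of_gram hA v).2
    rw [hv] at this
    linarith
  · apply Real.le_sqrt_of_sq_le
    have := (eucNorm_le_of_gram hA (v ᵥ* ((A⁻¹ : SLR n) : Matrix (Fin n) (Fin n) ℝ))).1
    rw [Matrix.vecMul_vecMul, coe_inv_mul_coe, Matrix.vecMul_one, hv] at this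
    set w := eucNorm (v ᵥ* ((A⁻¹ : SLR n) : Matrix (Fin n) (Fin n) ℝ)) ^ 2
    have hw : 0 ≤ w := by positivity
    have h1 : (1 - ε / 2) * w ≤ 1 := by nlinarith
    nlinarith

lemma eucNorm_vecMul_le_opNorm {n : ℕ} (g : SLR n) (v : Fin n → ℝ) (hv : eucNorm v = 1) :
    eucNorm (v ᵥ* (g : Matrix (Fin n) (Fin n) ℝ)) ≤ opNorm g := by
  refine le_csSup ⟨√(∑ j, ∑ i, g i j ^ 2), ?_⟩ ⟨v, hv, rfl⟩
  rintro r ⟨w, hw, rfl⟩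
  refine Real.sqrt_le_sqrt (Finset.sum_le_sum fun j _ => ?_)
  have h := Finset.sum_mul_sq_le_sq_mul_sq Finset.univ w (fun i => g i j)
  have h1 : ∑ i, w i ^ 2 = 1 := by
    rw [eucNorm, Real.sqrt_eq_one] at hw; exact hw
  rw [h1, one_mul] at h
  exact h

lemma eucNorm_smul {n : ℕ} (c : ℝ) (v : Fin n → ℝ) : eucNorm (c • v) = |c| * eucNorm v := by
  rw [← sq_eq_sq₀ (eucNorm_nonneg _) (mul_nonneg (abs_nonneg _) (eucNorm_nonneg _)), mul_pow,
    eucNorm_sq, eucNorm_sq, sq_abs, smul_dotProduct, dotProduct_smul]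
  simp only [smul_eq_mul]
  ring

lemma eucNorm_vecMul_le {n : ℕ} (g : SLR n) (v : Fin n → ℝ) :
    eucNorm (v ᵥ* (g : Matrix (Fin n) (Fin n) ℝ)) ≤ opNorm g * eucNorm v := by
  rcases (eucNorm_nonneg v).eq_or_lt with h | h
  · have hv : v = 0 := by
      have := eucNorm_sq v
      rw [← h] at this
      exact dotProduct_self_eq_zero.1 (by linarith)
    subst hv
    rw [Matrix.zero_vecMul, ← h, mul_zero]
  · have h1 : eucNorm ((eucNorm v)⁻¹ • v) = 1 := by
      rw [eucNorm_smul, abs_of_pos (inv_pos.2 h), inv_mul_cancel₀ h.ne']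
    have h2 := eucNorm_vecMul_le_opNorm g _ h1
    rw [Matrix.smul_vecMul, eucNorm_smul, abs_of_pos (inv_pos.2 h), inv_mul_le_iff₀ h] at h2
    linarith

/-- Elements of the norm ball are nearly orthogonal. -/
lemma abs_gram_sub_one_le_of_mem_Oball {n : ℕ} {g : SLR n} {ε : ℝ} (hε : 0 < ε) (hε1 : ε ≤ 1)
    (hg : g ∈ Oball n ε) (i j : Fin n) :
    |((g : Matrix (Fin n) (Fin n) ℝ) * (g : Matrix (Fin n) (Fin n) ℝ)ᵀ - 1) i j| ≤ 6 * ε := by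
  set E := (g : Matrix (Fin n) (Fin n) ℝ) * (g : Matrix (Fin n) (Fin n) ℝ)ᵀ - 1 with hE
  have h1 : opNorm g ≤ 1 + ε := ((le_max_left _ _).trans_lt hg).le
  have h2 : opNorm g⁻¹ ≤ 1 + ε := ((le_max_right _ _).trans_lt hg).le
  have hq : ∀ v : Fin n → ℝ, |v ⬝ᵥ E *ᵥ v| ≤ 3 * ε * (v ⬝ᵥ v) := by
    intro v
    have e := eucNorm_vecMul_sq (g : Matrix (Fin n) (Fin n) ℝ) v
    rw [← hE] at e
    have a := (eucNorm_vecMul_le g v).trans (mul_le_mul_of_nonneg_right h1 (eucNorm_nonneg v))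
    have b := (eucNorm_vecMul_le g⁻¹ (v ᵥ* (g : Matrix (Fin n) (Fin n) ℝ))).trans
      (mul_le_mul_of_nonneg_right h2 (eucNorm_nonneg _))
    rw [Matrix.vecMul_vecMul, coe_mul_coe_inv, Matrix.vecMul_one] at b
    rw [← eucNorm_sq]
    have nx := eucNorm_nonneg v
    have ny := eucNorm_nonneg (v ᵥ* (g : Matrix (Fin n) (Fin n) ℝ))
    set x := eucNorm v
    set y := eucNorm (v ᵥ* (g : Matrix (Fin n) (Fin n) ℝ))
    have a2 : y ^ 2 ≤ (1 + ε) ^ 2 * x ^ 2 := by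
      rw [← mul_pow]; exact pow_le_pow_left₀ ny a 2
    have b2 : x ^ 2 ≤ (1 + ε) ^ 2 * y ^ 2 := by
      rw [← mul_pow]; exact pow_le_pow_left₀ nx b 2
    have hee : (1 + ε) ^ 2 ≤ 1 + 3 * ε := by nlinarith
    have a3 := a2.trans (mul_le_mul_of_nonneg_right hee (sq_nonneg x))
    have b3 := b2.trans (mul_le_mul_of_nonneg_right hee (sq_nonneg y))
    rw [abs_le]
    constructor
    · by_contra hc
      push Not at hc
      have : y ^ 2 < x ^ 2 := by nlinarith [mul_nonneg hε.le (sq_nonneg x)]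
      nlinarith
    · linarith
  have hd : ∀ i, |E i i| ≤ 3 * ε := by
    intro i
    have := hq (Pi.single i 1)
    simpa using this
  by_cases hij : i = j
  · subst hij
    linarith [hd i]
  · have hs : E j i = E i j := by
      simp only [hE, Matrix.sub_apply, Matrix.mul_apply, Matrix.transpose_apply]
      rw [Matrix.one_apply_ne hij, Matrix.one_apply_ne (Ne.symm hij)]
      simp only [mul_comm]
    have := hq (Pi.single i 1 + Pi.single j 1)
    simp only [Matrix.mulVec_add, dotProduct_add, add_dotProduct, Matrix.mulVec_single_one,
      single_dotProduct, Matrix.col_apply, one_mul, hs, Pi.single_eq_same,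
      Pi.single_eq_of_ne hij, Pi.single_eq_of_ne (Ne.symm hij)] at this
    have a := abs_le.1 this
    have b := abs_le.1 (hd i)
    have c := abs_le.1 (hd j)
    rw [abs_le]
    constructor <;> linarith [a.1, a.2, b.1, b.2, c.1, c.2]

lemma mul_apply_self_of_upper {n : ℕ} {A B : Matrix (Fin n) (Fin n) ℝ}
    (hA : A.BlockTriangular id) (hB : B.BlockTriangular id) (i : Fin n) :
    (A * B) i i = A i i * B i i := by
  rw [Matrix.mul_apply, Finset.sum_eq_single i]
  · intro k _ hk
    rcases lt_or_gt_of_ne hk with h | h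
    · rw [hA h, zero_mul]
    · rw [hB h, mul_zero]
  · simp

lemma blockTriangular_coe_inv {n : ℕ} {b : SLR n}
    (hb : (b : Matrix (Fin n) (Fin n) ℝ).BlockTriangular id) :
    ((b⁻¹ : SLR n) : Matrix (Fin n) (Fin n) ℝ).BlockTriangular id := by
  let _ : Invertible (b : Matrix (Fin n) (Fin n) ℝ) := ⟨_, coe_inv_mul_coe b, coe_mul_coe_inv b⟩
  have := Matrix.blockTriangular_inv_of_blockTriangular hb
  rwa [← Matrix.invOf_eq_nonsing_inv] at this

/-- Upper triangular elements with positive diagonal whose cosets by nearly orthogonal elements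
meet are close to each other. -/
lemma abs_sub_le_of_mul_eq {n : ℕ} {b b' a a' : SLR n} {R δ : ℝ}
    (hb : (b : Matrix (Fin n) (Fin n) ℝ).BlockTriangular id)
    (hb' : (b' : Matrix (Fin n) (Fin n) ℝ).BlockTriangular id)
    (hpos : ∀ i, 0 < b i i) (hpos' : ∀ i, 0 < b' i i)
    (hR : ∀ i j, |b i j| ≤ R) (hR' : ∀ i j, |b' i j| ≤ R)
    (hRi : ∀ i j, |b⁻¹ i j| ≤ R) (hRi' : ∀ i j, |b'⁻¹ i j| ≤ R) (hR0 : 0 ≤ R) (hδ : 0 ≤ δ)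
    (ha : ∀ i j, |((a : Matrix (Fin n) (Fin n) ℝ) * (a : Matrix (Fin n) (Fin n) ℝ)ᵀ - 1) i j| ≤ δ)
    (ha' : ∀ i j,
      |((a' : Matrix (Fin n) (Fin n) ℝ) * (a' : Matrix (Fin n) (Fin n) ℝ)ᵀ - 1) i j| ≤ δ)
    (h : b * a = b' * a') (i j : Fin n) :
    |b i j - b' i j| ≤ n * R * (2 * (n * (n * R * R) * δ)) := by
  set c : SLR n := b'⁻¹ * b with hc
  have hca : c * a = a' := by rw [hc, mul_assoc, h, inv_mul_cancel_left]
  have hcinv : c⁻¹ = b⁻¹ * b' := by rw [hc, _root_.mul_inv_rev, inv_inv]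
  have hctri : (c : Matrix (Fin n) (Fin n) ℝ).BlockTriangular id := by
    rw [hc, Matrix.SpecialLinearGroup.coe_mul]
    exact (blockTriangular_coe_inv hb').mul hb
  have hcitri := blockTriangular_coe_inv hctri
  have hcb : ∀ i j, |c i j| ≤ n * R * R := by
    rw [hc, Matrix.SpecialLinearGroup.coe_mul]; exact abs_mul_apply_le hR0 hRi' hR
  have hcib : ∀ i j, |c⁻¹ i j| ≤ n * R * R := by
    rw [hcinv, Matrix.SpecialLinearGroup.coe_mul]; exact abs_mul_apply_le hR0 hRi hR'
  have hbc : (b : Matrix (Fin n) (Fin n) ℝ) = (b' : Matrix (Fin n) (Fin n) ℝ) * c := by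
    rw [← Matrix.SpecialLinearGroup.coe_mul, hc, mul_inv_cancel_left]
  have hcpos : ∀ i, 0 < c i i := by
    intro i
    have e := mul_apply_self_of_upper hb' hctri i
    rw [← hbc] at e
    have := hpos i
    rw [e] at this
    exact (mul_pos_iff_of_pos_left (hpos' i)).1 this
  have hF : (c : Matrix (Fin n) (Fin n) ℝ)ᵀ - ((c⁻¹ : SLR n) : Matrix (Fin n) (Fin n) ℝ) =
      ((c⁻¹ : SLR n) : Matrix (Fin n) (Fin n) ℝ) *
        ((a' : Matrix (Fin n) (Fin n) ℝ) * (a' : Matrix (Fin n) (Fin n) ℝ)ᵀ - 1) -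
      ((a : Matrix (Fin n) (Fin n) ℝ) * (a : Matrix (Fin n) (Fin n) ℝ)ᵀ - 1) *
        (c : Matrix (Fin n) (Fin n) ℝ)ᵀ := by
    have e1 : ((c⁻¹ : SLR n) : Matrix (Fin n) (Fin n) ℝ) * (a' : Matrix (Fin n) (Fin n) ℝ) =
        (a : Matrix (Fin n) (Fin n) ℝ) := by
      rw [← Matrix.SpecialLinearGroup.coe_mul, ← hca, inv_mul_cancel_left]
    have e2 : (a' : Matrix (Fin n) (Fin n) ℝ)ᵀ =
        (a : Matrix (Fin n) (Fin n) ℝ)ᵀ * (c : Matrix (Fin n) (Fin n) ℝ)ᵀ := by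
      rw [← Matrix.transpose_mul, ← Matrix.SpecialLinearGroup.coe_mul, hca]
    rw [Matrix.mul_sub, Matrix.sub_mul, ← Matrix.mul_assoc, e1, e2, Matrix.mul_one,
      Matrix.one_mul, Matrix.mul_assoc]
    abel
  have hB0 : 0 ≤ n * R * R := by positivity
  have hFb : ∀ i j, |c j i - c⁻¹ i j| ≤ 2 * (n * (n * R * R) * δ) := by
    intro i j
    have e : c j i - c⁻¹ i j = ((c : Matrix (Fin n) (Fin n) ℝ)ᵀ -
      ((c⁻¹ : SLR n) : Matrix (Fin n) (Fin n) ℝ)) i j := by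
      rw [Matrix.sub_apply, Matrix.transpose_apply]
    rw [e, hF, Matrix.sub_apply]
    have h1 := abs_mul_apply_le hB0 hcib ha' i j
    have h2 := abs_mul_apply_le hδ ha (B := (c : Matrix (Fin n) (Fin n) ℝ)ᵀ)
      (fun i j => hcb j i) i j
    refine (abs_sub _ _).trans ((add_le_add h1 h2).trans (le_of_eq ?_))
    ring
  have hc1 : ∀ i j, |((c : Matrix (Fin n) (Fin n) ℝ) - 1) i j| ≤ 2 * (n * (n * R * R) * δ) := by
    intro i j
    rw [Matrix.sub_apply]
    rcases lt_trichotomy i j with hij | hij | hij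
    · have := hFb j i
      rw [hcitri hij, sub_zero] at this
      rwa [Matrix.one_apply_ne hij.ne, sub_zero]
    · subst hij
      rw [Matrix.one_apply_eq]
      have h1 := hFb i i
      have h2 : c i i * c⁻¹ i i = 1 := by
        rw [← mul_apply_self_of_upper hctri hcitri, coe_mul_coe_inv, Matrix.one_apply_eq]
      have h3 : c i i - c⁻¹ i i = (c i i - 1) * (1 + c⁻¹ i i) := by linear_combination -h2
      have h4 : 0 < c⁻¹ i i := (mul_pos_iff_of_pos_left (hcpos i)).1 (by rw [h2]; norm_num)
      rw [h3, abs_mul, abs_of_pos (by linarith : 0 < 1 + c⁻¹ i i)] at h1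
      nlinarith [abs_nonneg (c i i - 1), mul_nonneg (abs_nonneg (c i i - 1)) h4.le]
    · rw [hctri hij, Matrix.one_apply_ne hij.ne', sub_zero, abs_zero]
      positivity
  have hfin : b i j - b' i j = ((b' : Matrix (Fin n) (Fin n) ℝ) *
      ((c : Matrix (Fin n) (Fin n) ℝ) - 1)) i j := by
    rw [Matrix.mul_sub, ← hbc, Matrix.mul_one, Matrix.sub_apply]
  rw [hfin]
  exact abs_mul_apply_le hR0 hR' hc1 i j

lemma continuous_coe_SLR (n : ℕ) :
    Continuous (fun g : SLR n => (g : Matrix (Fin n) (Fin n) ℝ)) :=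
  continuous_induced_dom

lemma continuous_apply_SLR {n : ℕ} (i j : Fin n) : Continuous (fun g : SLR n => g i j) :=
  (continuous_coe_SLR n).matrix_elem i j

lemma isOpen_entryBox (n : ℕ) : IsOpen (entryBox n) := by
  simp only [entryBox, Set.ofPred_forall]
  refine isOpen_iInter_of_finite fun i => isOpen_iInter_of_finite fun j => ?_
  exact (isOpen_lt (continuous_apply_SLR i j).abs continuous_const).inter
    (isOpen_lt ((continuous_apply_SLR i j).comp continuous_inv).abs continuous_const)

lemma one_mem_entryBox (n : ℕ) : (1 : SLR n) ∈ entryBox n := by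
  intro i j
  rw [inv_one, Matrix.SpecialLinearGroup.coe_one, Matrix.one_apply]
  split_ifs <;> norm_num

lemma isCompact_setOf_abs_apply_le (n : ℕ) (R : ℝ) :
    IsCompact {g : SLR n | ∀ i j, |g i j| ≤ R} := by
  have he : Topology.IsClosedEmbedding (fun g : SLR n => (g : Matrix (Fin n) (Fin n) ℝ)) := by
    refine ⟨⟨⟨rfl⟩, Subtype.val_injective⟩, ?_⟩
    have : Set.range (fun g : SLR n => (g : Matrix (Fin n) (Fin n) ℝ)) =
        {A | A.det = 1} := Subtype.range_coe
    rw [this]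
    exact isClosed_eq (continuous_id.matrix_det) continuous_const
  have hK : IsCompact (Set.univ.pi fun _ : Fin n => Set.univ.pi fun _ : Fin n =>
      Set.Icc (-R) R) :=
    isCompact_univ_pi fun _ => isCompact_univ_pi fun _ => isCompact_Icc
  convert he.isCompact_preimage hK using 1
  ext g
  exact ⟨fun h i _ j _ => abs_le.1 (h i j), fun h i j => abs_le.2 (h i trivial j trivial)⟩

/-- Elements of `SL_n(ℝ)` that are orthogonal up to an error `δ`. -/
def nearOrthogonal (n : ℕ) (δ : ℝ) : Set (SLR n) :=
  {a | ∀ i j, |((a : Matrix (Fin n) (Fin n) ℝ) * (a : Matrix (Fin n) (Fin n) ℝ)ᵀ - 1) i j| ≤ δ}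

lemma isClosed_nearOrthogonal (n : ℕ) (δ : ℝ) : IsClosed (nearOrthogonal n δ) := by
  simp only [nearOrthogonal, Set.ofPred_forall]
  refine isClosed_iInter fun i => isClosed_iInter fun j => ?_
  have hc := continuous_coe_SLR n
  exact isClosed_le (((hc.matrix_mul hc.matrix_transpose).sub continuous_const).matrix_elem
    i j).abs continuous_const

lemma abs_apply_le_of_mem_nearOrthogonal {n : ℕ} {δ : ℝ} (hδ : δ ≤ 6) {a : SLR n}
    (ha : a ∈ nearOrthogonal n δ) (i j : Fin n) : |a i j| ≤ 3 := by
  have h := (abs_le.1 (ha i i)).2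
  rw [Matrix.sub_apply, Matrix.one_apply_eq, Matrix.mul_apply] at h
  have h1 := Finset.single_le_sum (f := fun k => a i k * a i k)
    (fun k _ => mul_self_nonneg _) (Finset.mem_univ j)
  simp only [Matrix.transpose_apply] at h h1
  exact abs_le_of_sq_le_sq (by nlinarith) (by norm_num)

/-- The first diagonal entries of `upperMatrix`, with value one in the last place. -/
def upperDiag {n : ℕ} (x : UpperIndex n → ℝ) (i : Fin n) : ℝ :=
  if h : (i : ℕ) + 1 < n then 1 + x ⟨(i, i), le_rfl, h⟩ else 1

/-- The upper triangular matrix of determinant one with given coordinates. -/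
def upperMatrix {n : ℕ} (x : UpperIndex n → ℝ) : Matrix (Fin n) (Fin n) ℝ :=
  Matrix.of fun i j =>
    if i = j then (if (i : ℕ) + 1 < n then upperDiag x i else (∏ k, upperDiag x k)⁻¹)
    else if h : i ≤ j ∧ (i : ℕ) + 1 < n then x ⟨(i, j), h⟩ else 0

lemma blockTriangular_upperMatrix {n : ℕ} (x : UpperIndex n → ℝ) :
    (upperMatrix x).BlockTriangular id := by
  intro i j hij
  have hij' : j < i := hij
  simp only [upperMatrix, Matrix.of_apply]
  rw [if_neg hij'.ne', dif_neg fun h => absurd h.1 (not_le.2 hij')]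

lemma one_le_upperDiag {n : ℕ} {x : UpperIndex n → ℝ} (hx : ∀ p, 0 ≤ x p) (i : Fin n) :
    1 ≤ upperDiag x i := by
  unfold upperDiag
  split_ifs with h
  · linarith [hx ⟨(i, i), le_rfl, h⟩]
  · exact le_rfl

lemma upperDiag_le_two {n : ℕ} {x : UpperIndex n → ℝ} (hx : ∀ p, x p ≤ 1) (i : Fin n) :
    upperDiag x i ≤ 2 := by
  unfold upperDiag
  split_ifs with h
  · linarith [hx ⟨(i, i), le_rfl, h⟩]
  · norm_num

lemma one_le_prod_upperDiag {n : ℕ} {x : UpperIndex n → ℝ} (hx : ∀ p, 0 ≤ x p) :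
    1 ≤ ∏ k, upperDiag x k := by
  have h := Finset.prod_le_prod (s := Finset.univ) (f := fun _ : Fin n => (1 : ℝ))
    (g := fun k => upperDiag x k) (fun _ _ => zero_le_one) (fun i _ => one_le_upperDiag hx i)
  simpa using h

lemma det_upperMatrix {n : ℕ} (hn : 1 ≤ n) {x : UpperIndex n → ℝ} (hx : ∀ p, 0 ≤ x p) :
    (upperMatrix x).det = 1 := by
  rw [Matrix.det_of_isUpperTriangular (blockTriangular_upperMatrix x)]
  have hl : ∀ i : Fin n, upperMatrix x i i =
      upperDiag x i * if i = ⟨n - 1, by omega⟩ then (∏ k, upperDiag x k)⁻¹ else 1 := by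
    intro i
    simp only [upperMatrix, Matrix.of_apply, if_true]
    by_cases h : (i : ℕ) + 1 < n
    · rw [if_pos h, if_neg, mul_one]
      rintro rfl
      simp only at h
      omega
    · rw [if_neg h, if_pos (Fin.ext (by simp only; omega)), upperDiag, dif_neg h, one_mul]
  rw [Finset.prod_congr rfl fun i _ => hl i, Finset.prod_mul_distrib, Finset.prod_ite_eq']
  simp only [Finset.mem_univ, if_true]
  exact mul_inv_cancel₀ (zero_lt_one.trans_le (one_le_prod_upperDiag hx)).ne'

lemma upperMatrix_diag_pos {n : ℕ} {x : UpperIndex n → ℝ} (hx : ∀ p, 0 ≤ x p) (i : Fin n) :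
    0 < upperMatrix x i i := by
  have h1 := one_le_upperDiag hx i
  have h2 := one_le_prod_upperDiag hx
  simp only [upperMatrix, Matrix.of_apply, if_true]
  split_ifs
  · linarith
  · positivity

lemma abs_upperMatrix_le {n : ℕ} {x : UpperIndex n → ℝ} (hx : ∀ p, 0 ≤ x p)
    (hx1 : ∀ p, x p ≤ 1) (i j : Fin n) : |upperMatrix x i j| ≤ 2 := by
  have h1 := one_le_upperDiag hx i
  have h2 := upperDiag_le_two hx1 i
  have h3 := one_le_prod_upperDiag hx
  simp only [upperMatrix, Matrix.of_apply]
  split_ifs with _ _ h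
  · rw [abs_of_nonneg (by linarith)]; exact h2
  · rw [abs_of_nonneg (by positivity)]
    exact (inv_le_one_of_one_le₀ h3).trans (by norm_num)
  · rw [abs_of_nonneg (hx _)]
    exact (hx1 _).trans (by norm_num)
  · norm_num

lemma upperMatrix_sub {n : ℕ} (x y : UpperIndex n → ℝ) (p : UpperIndex n) :
    upperMatrix x p.1.1 p.1.2 - upperMatrix y p.1.1 p.1.2 = x p - y p := by
  obtain ⟨⟨i, j⟩, hij, hi⟩ := p
  simp only [upperMatrix, Matrix.of_apply]
  by_cases h : i = j
  · subst h
    simp [hi, upperDiag]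
  · have hij' : i ≤ j := hij
    have hi' : (i : ℕ) + 1 < n := hi
    simp [h, hij', hi']

/-- Packing bound: many disjoint translates of the near-orthogonal set fit into a compact set. -/
lemma exists_measure_nearOrthogonal_le (n : ℕ) (hn : 1 ≤ n) (μ : Measure (SLR n))
    [μ.IsHaarMeasure] :
    ∃ C : ℝ, 0 ≤ C ∧ ∀ ε : ℝ, 0 < ε → ε ≤ 1 →
      μ (nearOrthogonal n (6 * ε)) ≤ ENNReal.ofReal (C * ε ^ dn n) := by
  set R : ℝ := max 2 ((Fintype.card (Fin n)).factorial • (max (2 : ℝ) 1) ^ Fintype.card (Fin n))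
    with hRdef
  have hR0 : 0 ≤ R := zero_le_two.trans (le_max_left _ _)
  set C₀ : ℝ := n * R * (2 * (n * (n * R * R) * 6)) with hC₀
  have hC₀0 : 0 ≤ C₀ := by positivity
  set K : Set (SLR n) := {g : SLR n | ∀ i j, |g i j| ≤ n * 2 * 3}
  have hK : μ K < ⊤ := (isCompact_setOf_abs_apply_le n _).measure_lt_top
  refine ⟨(C₀ + 1) ^ dn n * (μ K).toReal, by positivity, fun ε hε hε1 => ?_⟩
  set s : ℝ := (C₀ + 1) * ε with hs
  have hs0 : 0 < s := by positivity
  set m : ℕ := ⌊1 / s⌋₊ + 1 with hm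
  set W := nearOrthogonal n (6 * ε) with hW
  let x : (UpperIndex n → Fin m) → UpperIndex n → ℝ := fun k p => s * (k p : ℕ)
  have hx0 : ∀ k p, 0 ≤ x k p := fun k p => by positivity
  have hx1 : ∀ k p, x k p ≤ 1 := by
    intro k p
    have h1 : ((k p : ℕ) : ℝ) ≤ ⌊1 / s⌋₊ := by exact_mod_cast Nat.lt_succ_iff.1 (k p).2
    have h2 := h1.trans (Nat.floor_le (by positivity))
    rw [le_div_iff₀ hs0] at h2
    simp only [x]
    linarith
  let b : (UpperIndex n → Fin m) → SLR n := fun k => ⟨upperMatrix (x k), det_upperMatrix hn (hx0 k)⟩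
  have hb2 : ∀ k i j, |b k i j| ≤ 2 := fun k i j => abs_upperMatrix_le (hx0 k) (hx1 k) i j
  let A : (UpperIndex n → Fin m) → Set (SLR n) := fun k => (fun g => (b k)⁻¹ * g) ⁻¹' W
  have hAm : ∀ k, MeasurableSet (A k) := fun k =>
    ((isClosed_nearOrthogonal n _).preimage (continuous_const.mul continuous_id)).measurableSet
  have hAμ : ∀ k, μ (A k) = μ W := fun k => measure_preimage_mul μ _ _
  have hAK : ∀ k, A k ⊆ K := by
    intro k g hg
    have e : g = b k * ((b k)⁻¹ * g) := (mul_inv_cancel_left _ _).symm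
    change ∀ i j, |g i j| ≤ n * 2 * 3
    rw [e, Matrix.SpecialLinearGroup.coe_mul]
    exact abs_mul_apply_le zero_le_two (hb2 k)
      (abs_apply_le_of_mem_nearOrthogonal (by linarith) hg)
  have hdisj : (↑(Finset.univ : Finset (UpperIndex n → Fin m)) :
      Set (UpperIndex n → Fin m)).PairwiseDisjoint A := by
    intro k _ k' _ hkk'
    refine Set.disjoint_left.2 fun g hg hg' => hkk' ?_
    have hle := abs_sub_le_of_mul_eq (b := b k) (b' := b k') (a := (b k)⁻¹ * g)
      (a' := (b k')⁻¹ * g) (R := R) (δ := 6 * ε)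
      (blockTriangular_upperMatrix _) (blockTriangular_upperMatrix _)
      (upperMatrix_diag_pos (hx0 k)) (upperMatrix_diag_pos (hx0 k'))
      (fun i j => (hb2 k i j).trans (le_max_left _ _))
      (fun i j => (hb2 k' i j).trans (le_max_left _ _))
      (fun i j => (abs_inv_apply_le _ (hb2 k) i j).trans (le_max_right _ _))
      (fun i j => (abs_inv_apply_le _ (hb2 k') i j).trans (le_max_right _ _))
      hR0 (by positivity) hg hg' (by rw [mul_inv_cancel_left, mul_inv_cancel_left])
    funext p
    have h1 : |x k p - x k' p| ≤ _ := (upperMatrix_sub (x k) (x k') p) ▸ hle p.1.1 p.1.2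
    have h2 : |x k p - x k' p| < s := by
      refine h1.trans_lt ?_
      have : n * R * (2 * (n * (n * R * R) * (6 * ε))) = C₀ * ε := by rw [hC₀]; ring
      rw [this, hs]
      nlinarith
    simp only [x, ← mul_sub, abs_mul, abs_of_pos hs0] at h2
    have h3 : |((k p : ℕ) : ℝ) - ((k' p : ℕ) : ℝ)| < 1 := by
      by_contra hc
      push Not at hc
      nlinarith
    have h4 : |((k p : ℕ) : ℤ) - ((k' p : ℕ) : ℤ)| < 1 := by exact_mod_cast h3
    rw [Int.abs_lt_one_iff] at h4
    exact Fin.ext (by omega)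
  have hsum := measure_biUnion_finset (μ := μ) hdisj fun k _ => hAm k
  have hle : ∑ k, μ (A k) ≤ μ K := by
    rw [← hsum]
    exact measure_mono (Set.iUnion₂_subset fun k _ => hAK k)
  simp only [hAμ, Finset.sum_const, Finset.card_univ, Fintype.card_fun, Fintype.card_fin,
    card_upperIndex, nsmul_eq_mul] at hle
  have hm1 : 1 ≤ m := by omega
  have hWK : μ W ≤ μ K := by
    refine le_trans ?_ hle
    have : (1 : ENNReal) ≤ ((m ^ dn n : ℕ) : ENNReal) := by exact_mod_cast Nat.one_le_pow _ _ hm1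
    calc μ W = 1 * μ W := (one_mul _).symm
      _ ≤ _ := by gcongr
  have hWt : μ W ≠ ⊤ := (hWK.trans_lt hK).ne
  rw [← ENNReal.ofReal_toReal hWt]
  apply ENNReal.ofReal_le_ofReal
  have h5 := ENNReal.toReal_mono hK.ne hle
  rw [ENNReal.toReal_mul, ENNReal.toReal_natCast, Nat.cast_pow] at h5
  have h6 : 1 ≤ s * m := by
    have := (Nat.lt_floor_add_one (1 / s)).le
    rw [div_le_iff₀ hs0] at this
    rw [hm]; push_cast; linarith
  calc (μ W).toReal ≤ (s * m) ^ dn n * (μ W).toReal :=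
        le_mul_of_one_le_left ENNReal.toReal_nonneg (one_le_pow₀ h6)
    _ = s ^ dn n * ((m : ℝ) ^ dn n * (μ W).toReal) := by rw [mul_pow, mul_assoc]
    _ ≤ s ^ dn n * (μ K).toReal := by gcongr
    _ = (C₀ + 1) ^ dn n * (μ K).toReal * ε ^ dn n := by rw [hs, mul_pow]; ring

/-- Covering bound: a fixed open set is covered by few translates of the norm ball. -/
lemma exists_measure_entryBox_le (n : ℕ) (hn : 1 ≤ n) (μ : Measure (SLR n))
    [μ.IsHaarMeasure] :
    ∃ C : ℝ, 0 < C ∧ ∀ ε : ℝ, 0 < ε → ε ≤ 1 → ∃ N : ℕ, N * ε ≤ C ∧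
      μ (entryBox n) ≤ (N ^ dn n : ℕ) * μ (Oball n ε) := by
  obtain ⟨C, hC, hgram⟩ := exists_abs_gram_inv_mul_sub_one_le n hn
  have hn' : (1 : ℝ) ≤ n := by exact_mod_cast hn
  refine ⟨16 * n ^ 2 * C + 3, by positivity, fun ε hε hε1 => ?_⟩
  have hnz : (n : ℝ) ≠ 0 := by positivity
  set η : ℝ := ε / (2 * n * C) with hη
  have hη0 : 0 < η := by positivity
  set m : ℕ := ⌈n * 2 * 2 / η⌉₊ with hm
  let q : SLR n → UpperIndex n → ℤ := fun g p =>
    ⌊((g : Matrix (Fin n) (Fin n) ℝ) * (g : Matrix (Fin n) (Fin n) ℝ)ᵀ) p.1.1 p.1.2 / η⌋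
  let Z : Finset (UpperIndex n → ℤ) := Fintype.piFinset fun _ => Finset.Icc (-(m : ℤ)) m
  have hqZ : ∀ g ∈ entryBox n, q g ∈ Z := by
    intro g hg
    rw [Fintype.mem_piFinset]
    intro p
    have h1 : |((g : Matrix (Fin n) (Fin n) ℝ) * (g : Matrix (Fin n) (Fin n) ℝ)ᵀ) p.1.1 p.1.2|
        ≤ n * 2 * 2 :=
      abs_mul_apply_le (by norm_num) (fun i j => (hg i j).1.le) (fun i j => (hg j i).1.le) _ _
    have h2 : |((g : Matrix (Fin n) (Fin n) ℝ) * (g : Matrix (Fin n) (Fin n) ℝ)ᵀ)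
        p.1.1 p.1.2 / η| ≤ m := by
      rw [abs_div, abs_of_pos hη0]
      exact (div_le_div_of_nonneg_right h1 hη0.le).trans (Nat.le_ceil _)
    rw [abs_le] at h2
    rw [Finset.mem_Icc]
    constructor
    · exact Int.le_floor.2 (by push_cast; exact h2.1)
    · have := (Int.floor_le _).trans h2.2
      exact_mod_cast this
  have hrep : ∀ z : UpperIndex n → ℤ, ∃ h : SLR n, h ∈ entryBox n ∧
      ((∃ g ∈ entryBox n, q g = z) → q h = z) := by
    intro z
    by_cases hz : ∃ g ∈ entryBox n, q g = z
    · obtain ⟨g, hg, hgz⟩ := hz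
      exact ⟨g, hg, fun _ => hgz⟩
    · exact ⟨1, one_mem_entryBox n, fun h => absurd h hz⟩
  choose r hrV hrq using hrep
  have hcover : entryBox n ⊆ ⋃ z ∈ Z, (fun g => (r z)⁻¹ * g) ⁻¹' Oball n ε := by
    intro g hg
    refine Set.mem_iUnion₂.2 ⟨q g, hqZ g hg, ?_⟩
    have hq := hrq (q g) ⟨g, hg, rfl⟩
    refine mem_Oball_of_gram hn (η := C * η) hε hε1 ?_
      (hgram g hg (r (q g)) (hrV _) η hη0.le fun p => ?_)
    · rw [hη]
      apply le_of_eq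
      field_simp
    · have h1 := Int.abs_sub_lt_one_of_floor_eq_floor (congrFun hq p).symm
      rw [← sub_div, abs_div, abs_of_pos hη0, div_lt_one hη0] at h1
      exact h1.le
  refine ⟨2 * m + 1, ?_, ?_⟩
  · have h1 := (Nat.ceil_lt_add_one (a := (n : ℝ) * 2 * 2 / η) (by positivity)).le
    rw [← hm] at h1
    have h2 : (n : ℝ) * 2 * 2 / η * ε = 8 * n ^ 2 * C := by
      rw [hη]; field_simp; ring
    push_cast
    nlinarith [mul_le_mul_of_nonneg_right h1 hε.le]
  · calc μ (entryBox n) ≤ μ (⋃ z ∈ Z, (fun g => (r z)⁻¹ * g) ⁻¹' Oball n ε) :=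
          measure_mono hcover
      _ ≤ ∑ z ∈ Z, μ ((fun g => (r z)⁻¹ * g) ⁻¹' Oball n ε) := measure_biUnion_finset_le _ _
      _ = ((2 * m + 1) ^ dn n : ℕ) * μ (Oball n ε) := by
          simp only [measure_preimage_mul, Finset.sum_const, nsmul_eq_mul]
          congr 2
          rw [Fintype.card_piFinset, Finset.prod_const, Finset.card_univ, card_upperIndex,
            Int.card_Icc]
          congr 1
          omega

/-- For `0 < ε ≤ 1`, the Haar measure of the norm ball `O_ε` is comparable to `ε^{d_n}`. -/
theorem haar_measure_norm_ball
    (n : ℕ) (hn : 3 ≤ n)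
    (μ : Measure (SLR n)) [μ.IsHaarMeasure] [μ.IsMulRightInvariant] :
    ∃ c₁ c₂ : ℝ, 0 < c₁ ∧ c₁ ≤ c₂ ∧ ∀ ε : ℝ, 0 < ε → ε ≤ 1 →
      ENNReal.ofReal (c₁ * ε ^ dn n) ≤ μ (Oball n ε) ∧
      μ (Oball n ε) ≤ ENNReal.ofReal (c₂ * ε ^ dn n) := by
  have hn1 : 1 ≤ n := by omega
  obtain ⟨C₂, -, hupper⟩ := exists_measure_nearOrthogonal_le n hn1 μ
  obtain ⟨C₁, hC₁, hlower⟩ := exists_measure_entryBox_le n hn1 μ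
  have hVpos : 0 < μ (entryBox n) :=
    (isOpen_entryBox n).measure_pos μ ⟨1, one_mem_entryBox n⟩
  have hVfin : μ (entryBox n) < ⊤ :=
    (measure_mono fun g hg i j => (hg i j).1.le).trans_lt
      (isCompact_setOf_abs_apply_le n 2).measure_lt_top
  have hv := ENNReal.toReal_pos hVpos.ne' hVfin.ne
  set v := (μ (entryBox n)).toReal
  refine ⟨v / C₁ ^ dn n, max (v / C₁ ^ dn n) C₂, by positivity, le_max_left _ _,
    fun ε hε hε1 => ?_⟩
  have hup : μ (Oball n ε) ≤ ENNReal.ofReal (C₂ * ε ^ dn n) :=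
    (measure_mono fun g hg => abs_gram_sub_one_le_of_mem_Oball hε hε1 hg).trans
      (hupper ε hε hε1)
  have hfin : μ (Oball n ε) ≠ ⊤ := (hup.trans_lt ENNReal.ofReal_lt_top).ne
  refine ⟨?_, hup.trans (ENNReal.ofReal_le_ofReal ?_)⟩
  · obtain ⟨N, hN, hle⟩ := hlower ε hε hε1
    have h1 := ENNReal.toReal_mono
      (ENNReal.mul_ne_top (ENNReal.natCast_ne_top _) hfin) hle
    rw [ENNReal.toReal_mul, ENNReal.toReal_natCast, Nat.cast_pow] at h1
    rw [← ENNReal.ofReal_toReal hfin]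
    apply ENNReal.ofReal_le_ofReal
    rw [div_mul_eq_mul_div, div_le_iff₀ (by positivity)]
    calc v * ε ^ dn n ≤ (N : ℝ) ^ dn n * (μ (Oball n ε)).toReal * ε ^ dn n := by gcongr
      _ = (μ (Oball n ε)).toReal * (N * ε) ^ dn n := by rw [mul_pow]; ring
      _ ≤ (μ (Oball n ε)).toReal * C₁ ^ dn n := by gcongr
  · exact mul_le_mul_of_nonneg_right (le_max_right _ _) (by positivity)

end
end
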